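/- Let G be a maxnil graph and let {x, y, z, t} be a minimal vertex cut set of G consisting of four distinct vertices. Then the subgraph S of G induced by {x, y, z, t} is either a complete graph K_4 or is isomorphic to a subgraph of the 4-cycle C_4. -/

import Mathlib

open SimpleGraph

/-- `H` is a minor of `G`: there is a family of nonempty, pairwise disjoint,
connected branch sets in `G`, one for each vertex of `H`, with an edge of `G`
between the branch sets of any two adjacent vertices of `H`. -/
def IsMinor {W V : Type} (H : SimpleGraph W) (G : SimpleGraph V) : Prop :=
  ∃ f : W → Set V,
    (∀ w, (f w).Nonempty) ∧
    (∀ w, (G.induce (f w)).Connected) ∧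
    (Pairwise fun w₁ w₂ => Disjoint (f w₁) (f w₂)) ∧
    ∀ ⦃w₁ w₂⦄, H.Adj w₁ w₂ → ∃ v₁ ∈ f w₁, ∃ v₂ ∈ f w₂, G.Adj v₁ v₂

/-- The result of a `∇Y`-move on the triangle `a b c` of `G`: delete the edges of
the triangle and add a new vertex (`none`) joined to `a`, `b`, `c`. -/
def triangleY {V : Type} (G : SimpleGraph V) (a b c : V) : SimpleGraph (Option V) :=
  (SimpleGraph.map Function.Embedding.some
      (G.deleteEdges {s(a, b), s(b, c), s(a, c)})) ⊔
    SimpleGraph.fromEdgeSet {s((none : Option V), some a), s(none, some b), s(none, some c)}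

/-- Membership in the Petersen family: the graphs obtained from `K₆` by
`∇Y`-moves and `Y∇`-moves (the inverse operation), up to isomorphism. -/
inductive IsPetersenFamily : ∀ {V : Type}, SimpleGraph V → Prop
  | k6 : IsPetersenFamily (⊤ : SimpleGraph (Fin 6))
  | deltaY {V : Type} {G : SimpleGraph V} {a b c : V} :
      IsPetersenFamily G → G.Adj a b → G.Adj b c → G.Adj a c →
      IsPetersenFamily (triangleY G a b c)
  | yDelta {V : Type} {G : SimpleGraph V} {a b c : V} :
      IsPetersenFamily (triangleY G a b c) → G.Adj a b → G.Adj b c → G.Adj a c →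
      IsPetersenFamily G
  | iso {V W : Type} {G : SimpleGraph V} {H : SimpleGraph W} :
      IsPetersenFamily G → G ≃g H → IsPetersenFamily H

/-- A graph is linklessly embeddable (nIL) iff it has no minor in the Petersen family. -/
def IsLinkless {V : Type} (G : SimpleGraph V) : Prop :=
  ∀ ⦃W : Type⦄ (P : SimpleGraph W), IsPetersenFamily P → ¬ IsMinor P G

/-- The graph obtained from `G` by adding the edge `ab`. -/
def addEdge {V : Type} (G : SimpleGraph V) (a b : V) : SimpleGraph V :=
  G ⊔ SimpleGraph.fromEdgeSet {s(a, b)}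

/-- A nIL graph is maxnil if adding any edge yields a graph that is not nIL. -/
def IsMaxnil {V : Type} (G : SimpleGraph V) : Prop :=
  IsLinkless G ∧ ∀ a b : V, a ≠ b → ¬ G.Adj a b → ¬ IsLinkless (addEdge G a b)

/-- `S` is a vertex cut set of the connected graph `G` if `G - S` is disconnected. -/
def IsVertexCut {V : Type} (G : SimpleGraph V) (S : Set V) : Prop :=
  G.Connected ∧ ¬ (G.induce Sᶜ).Preconnected

/-- A vertex cut set is minimal if no proper subset of it is a vertex cut set. -/
def IsMinimalVertexCut {V : Type} (G : SimpleGraph V) (S : Set V) : Prop :=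
  IsVertexCut G S ∧ ∀ S' ⊂ S, ¬ IsVertexCut G S'

/-- A set `T` of vertices of `H` (inducing a `K₄`) is strongly separating if `H - T`
has at least two connected components such that every vertex of `T` has a
neighbor in each of them. -/
def StronglySeparating {V : Type} (H : SimpleGraph V) (T : Set V) : Prop :=
  ∃ C₁ C₂ : (H.induce Tᶜ).ConnectedComponent, C₁ ≠ C₂ ∧
    ∀ v ∈ T, (∃ u ∈ C₁.supp, H.Adj v ↑u) ∧ (∃ u ∈ C₂.supp, H.Adj v ↑u)

/-- `G` is maximal without a `K₆` minor. -/
def IsMaximalK6MinorFree {V : Type} (G : SimpleGraph V) : Prop :=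
  ¬ IsMinor (⊤ : SimpleGraph (Fin 6)) G ∧
    ∀ a b : V, a ≠ b → ¬ G.Adj a b → IsMinor (⊤ : SimpleGraph (Fin 6)) (addEdge G a b)

/-! ### The seven graphs of the Petersen family, encoded as bit matrices -/

/-- Adjacency coded by the bits of a natural number. -/
def LG (n c : ℕ) : SimpleGraph (Fin n) where
  Adj u w := u ≠ w ∧ (c.testBit (u * n + w) = true ∨ c.testBit (w * n + u) = true)
  symm := ⟨fun _ _ h => ⟨h.1.symm, h.2.symm⟩⟩
  loopless := ⟨fun _ h => h.1 rfl⟩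

instance (n c : ℕ) : DecidableRel (LG n c).Adj := fun u w =>
  inferInstanceAs (Decidable (u ≠ w ∧ (c.testBit (u * n + w) = true ∨ c.testBit (w * n + u) = true)))

/-- An entry `⟨n, c, u, v, w, c', σ⟩` records that the `∇Y`-move on the triangle `u v w` of
`LG n c` gives `LG (n+1) c'`, the isomorphism being listed by `σ` (new vertex last). -/
structure PEnt where
  n : ℕ
  c : ℕ
  u : ℕ
  v : ℕ
  w : ℕ
  d : ℕ
  s : List ℕ

def petData : List (ℕ × ℕ) :=
  [(6, 34089189246),
   (7, 31864211258488),
   (7, 266764620717628),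
   (8, 1803444976403118304),
   (8, 4037344607124093048),
   (9, 198570112439766644596960),
   (10, 64423686450991080519674183904)]
def petTable : List PEnt :=
  [⟨6, 34089189246, 0, 1, 2, 31864211258488, [0, 1, 2, 3, 4, 5, 6]⟩,
   ⟨7, 266764620717628, 4, 5, 6, 1803444976403118304, [1, 2, 3, 4, 5, 6, 7, 0]⟩,
   ⟨7, 31864211258488, 0, 3, 4, 1803444976403118304, [0, 3, 4, 1, 2, 5, 7, 6]⟩,
   ⟨7, 31864211258488, 0, 3, 4, 1803444976403118304, [0, 1, 2, 3, 4, 5, 6, 7]⟩,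
   ⟨7, 31864211258488, 3, 4, 5, 4037344607124093048, [3, 4, 5, 0, 1, 2, 7, 6]⟩,
   ⟨7, 31864211258488, 3, 4, 5, 4037344607124093048, [0, 1, 2, 3, 4, 5, 6, 7]⟩,
   ⟨8, 1803444976403118304, 2, 4, 5, 198570112439766644596960, [8, 4, 6, 2, 7, 5, 1, 3, 0]⟩,
   ⟨8, 1803444976403118304, 2, 4, 5, 198570112439766644596960, [7, 5, 6, 2, 8, 4, 0, 3, 1]⟩,
   ⟨8, 1803444976403118304, 2, 4, 5, 198570112439766644596960, [6, 5, 7, 4, 8, 2, 0, 1, 3]⟩,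
   ⟨8, 1803444976403118304, 1, 3, 5, 198570112439766644596960, [3, 0, 4, 1, 5, 2, 7, 8, 6]⟩,
   ⟨8, 1803444976403118304, 1, 3, 5, 198570112439766644596960, [1, 0, 2, 3, 5, 4, 6, 8, 7]⟩,
   ⟨8, 1803444976403118304, 1, 3, 5, 198570112439766644596960, [0, 1, 2, 3, 4, 5, 6, 7, 8]⟩,
   ⟨9, 198570112439766644596960, 2, 4, 5, 64423686450991080519674183904, [1, 3, 5, 9, 7, 6, 8, 4, 2, 0]⟩,
   ⟨9, 198570112439766644596960, 2, 4, 5, 64423686450991080519674183904, [0, 3, 4, 9, 8, 6, 7, 5, 2, 1]⟩,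
   ⟨9, 198570112439766644596960, 2, 4, 5, 64423686450991080519674183904, [0, 4, 3, 8, 9, 6, 7, 5, 1, 2]⟩,
   ⟨9, 198570112439766644596960, 2, 4, 5, 64423686450991080519674183904, [0, 1, 2, 9, 8, 7, 6, 5, 4, 3]⟩,
   ⟨9, 198570112439766644596960, 2, 4, 5, 64423686450991080519674183904, [0, 2, 1, 8, 9, 7, 6, 5, 3, 4]⟩,
   ⟨9, 198570112439766644596960, 2, 4, 5, 64423686450991080519674183904, [1, 2, 0, 7, 9, 8, 6, 4, 3, 5]⟩,
   ⟨9, 198570112439766644596960, 2, 4, 5, 64423686450991080519674183904, [3, 4, 0, 5, 1, 2, 7, 8, 9, 6]⟩,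
   ⟨9, 198570112439766644596960, 2, 4, 5, 64423686450991080519674183904, [1, 2, 0, 5, 3, 4, 6, 8, 9, 7]⟩,
   ⟨9, 198570112439766644596960, 2, 4, 5, 64423686450991080519674183904, [0, 2, 1, 4, 3, 5, 6, 7, 9, 8]⟩,
   ⟨9, 198570112439766644596960, 2, 4, 5, 64423686450991080519674183904, [0, 1, 2, 3, 4, 5, 6, 7, 8, 9]⟩,
   ⟨6, 34089189246, 0, 1, 3, 31864211258488, [0, 1, 3, 2, 4, 5, 6]⟩,
   ⟨6, 34089189246, 0, 1, 4, 31864211258488, [0, 1, 3, 4, 2, 5, 6]⟩,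
   ⟨6, 34089189246, 0, 1, 5, 31864211258488, [0, 1, 3, 4, 5, 2, 6]⟩,
   ⟨6, 34089189246, 0, 2, 3, 31864211258488, [0, 3, 1, 2, 4, 5, 6]⟩,
   ⟨6, 34089189246, 0, 2, 4, 31864211258488, [0, 3, 1, 4, 2, 5, 6]⟩,
   ⟨6, 34089189246, 0, 2, 5, 31864211258488, [0, 3, 1, 4, 5, 2, 6]⟩,
   ⟨6, 34089189246, 0, 3, 4, 31864211258488, [0, 3, 4, 1, 2, 5, 6]⟩,
   ⟨6, 34089189246, 0, 3, 5, 31864211258488, [0, 3, 4, 1, 5, 2, 6]⟩,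
   ⟨6, 34089189246, 0, 4, 5, 31864211258488, [0, 3, 4, 5, 1, 2, 6]⟩,
   ⟨6, 34089189246, 1, 2, 3, 31864211258488, [3, 0, 1, 2, 4, 5, 6]⟩,
   ⟨6, 34089189246, 1, 2, 4, 31864211258488, [3, 0, 1, 4, 2, 5, 6]⟩,
   ⟨6, 34089189246, 1, 2, 5, 31864211258488, [3, 0, 1, 4, 5, 2, 6]⟩,
   ⟨6, 34089189246, 1, 3, 4, 31864211258488, [3, 0, 4, 1, 2, 5, 6]⟩,
   ⟨6, 34089189246, 1, 3, 5, 31864211258488, [3, 0, 4, 1, 5, 2, 6]⟩,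
   ⟨6, 34089189246, 1, 4, 5, 31864211258488, [3, 0, 4, 5, 1, 2, 6]⟩,
   ⟨6, 34089189246, 2, 3, 4, 31864211258488, [3, 4, 0, 1, 2, 5, 6]⟩,
   ⟨6, 34089189246, 2, 3, 5, 31864211258488, [3, 4, 0, 1, 5, 2, 6]⟩,
   ⟨6, 34089189246, 2, 4, 5, 31864211258488, [3, 4, 0, 5, 1, 2, 6]⟩,
   ⟨6, 34089189246, 3, 4, 5, 31864211258488, [3, 4, 5, 0, 1, 2, 6]⟩,
   ⟨7, 31864211258488, 0, 3, 5, 1803444976403118304, [0, 1, 2, 3, 5, 4, 6, 7]⟩,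
   ⟨7, 31864211258488, 0, 4, 5, 1803444976403118304, [0, 1, 2, 5, 3, 4, 6, 7]⟩,
   ⟨7, 31864211258488, 1, 3, 4, 1803444976403118304, [1, 0, 2, 3, 4, 5, 6, 7]⟩,
   ⟨7, 31864211258488, 1, 3, 5, 1803444976403118304, [1, 0, 2, 3, 5, 4, 6, 7]⟩,
   ⟨7, 31864211258488, 1, 4, 5, 1803444976403118304, [1, 0, 2, 5, 3, 4, 6, 7]⟩,
   ⟨7, 31864211258488, 2, 3, 4, 1803444976403118304, [1, 2, 0, 3, 4, 5, 6, 7]⟩,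
   ⟨7, 31864211258488, 2, 3, 5, 1803444976403118304, [1, 2, 0, 3, 5, 4, 6, 7]⟩,
   ⟨7, 31864211258488, 2, 4, 5, 1803444976403118304, [1, 2, 0, 5, 3, 4, 6, 7]⟩,
   ⟨7, 266764620717628, 0, 2, 4, 1803444976403118304, [6, 3, 7, 1, 5, 2, 4, 0]⟩,
   ⟨7, 266764620717628, 0, 3, 4, 1803444976403118304, [6, 3, 1, 7, 5, 2, 4, 0]⟩,
   ⟨7, 266764620717628, 0, 4, 5, 1803444976403118304, [6, 3, 1, 2, 5, 7, 4, 0]⟩,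
   ⟨7, 266764620717628, 1, 2, 4, 1803444976403118304, [1, 7, 6, 3, 5, 4, 2, 0]⟩,
   ⟨7, 266764620717628, 1, 3, 4, 1803444976403118304, [1, 7, 3, 6, 5, 4, 2, 0]⟩,
   ⟨7, 266764620717628, 1, 4, 5, 1803444976403118304, [1, 7, 3, 4, 5, 6, 2, 0]⟩,
   ⟨7, 266764620717628, 2, 4, 6, 1803444976403118304, [1, 2, 6, 3, 5, 4, 7, 0]⟩,
   ⟨7, 266764620717628, 3, 4, 6, 1803444976403118304, [1, 2, 3, 6, 5, 4, 7, 0]⟩,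
   ⟨8, 1803444976403118304, 1, 4, 5, 198570112439766644596960, [0, 1, 2, 4, 3, 5, 6, 7, 8]⟩,
   ⟨8, 1803444976403118304, 2, 3, 5, 198570112439766644596960, [0, 2, 1, 3, 4, 5, 6, 7, 8]⟩]

/-- membership in the triangle of an entry -/
def PEnt.inT (e : PEnt) (p : ℕ) : Prop := p = e.u ∨ p = e.v ∨ p = e.w

instance (e : PEnt) (p : ℕ) : Decidable (e.inT p) :=
  inferInstanceAs (Decidable (p = e.u ∨ p = e.v ∨ p = e.w))

/-- the vertex map of an entry -/
def PEnt.map (e : PEnt) (p : ℕ) : Fin (e.n + 1) := Fin.ofNat (e.n + 1) (e.s.getD p 0)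

/-- validity of an entry -/
def PEnt.Valid (e : PEnt) : Prop :=
  (e.n, e.c) ∈ petData ∧ (e.n + 1, e.d) ∈ petData ∧
  (∃ a b c : Fin e.n, a.val = e.u ∧ b.val = e.v ∧ c.val = e.w ∧ (LG e.n e.c).Adj a b ∧
    (LG e.n e.c).Adj b c ∧ (LG e.n e.c).Adj a c) ∧
  (∀ p q : Fin e.n, (e.map p = e.map q → p = q) ∧
    ((LG (e.n + 1) e.d).Adj (e.map p) (e.map q) ↔
      ((LG e.n e.c).Adj p q ∧ ¬ (e.inT p ∧ e.inT q)))) ∧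
  (∀ p : Fin e.n, e.map e.n ≠ e.map p ∧
    ((LG (e.n + 1) e.d).Adj (e.map e.n) (e.map p) ↔ e.inT p))

instance (e : PEnt) : Decidable e.Valid := by unfold PEnt.Valid; infer_instance

theorem petTable_valid : ∀ e ∈ petTable, e.Valid := by decide +kernel

theorem petTable_tri : ∀ d ∈ petData, ∀ a b c : Fin d.1,
    (LG d.1 d.2).Adj a b → (LG d.1 d.2).Adj b c → (LG d.1 d.2).Adj a c →
    ∃ e ∈ petTable, e.n = d.1 ∧ e.c = d.2 ∧
      ∀ p : Fin d.1, (p = a ∨ p = b ∨ p = c) ↔ e.inT p := by decide +kernel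

theorem petTable_Y : ∀ d ∈ petData, ∀ v : Fin d.1,
    (Finset.univ.filter fun w => (LG d.1 d.2).Adj v w).card = 3 →
    ∃ e ∈ petTable, e.n + 1 = d.1 ∧ e.d = d.2 ∧ (e.map e.n).val = v.val := by decide +kernel

/-! ### Small separators of the seven graphs -/

/-- one step of breadth first search inside the vertex set `m` -/
def bfsStep (n c m s : ℕ) : ℕ :=
  Nat.lor s (Nat.land m
    ((List.range n).foldr (fun i r => if s.testBit i then Nat.lor (c >>> (i * n)) r else r) 0))

/-- iterated breadth first search -/
def bfs (n c m : ℕ) : ℕ → ℕ → ℕ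
  | 0, s => s
  | k + 1, s => bfsStep n c m (bfs n c m k s)

/-- the connected set `{u, w}` avoids `m` and is adjacent to every vertex of `m` -/
def FullPair (n c m : ℕ) (u w : Fin n) : Prop :=
  m.testBit u = false ∧ m.testBit w = false ∧ (u = w ∨ (LG n c).Adj u w) ∧
    ∀ t : Fin n, m.testBit t = true → (LG n c).Adj t u ∨ (LG n c).Adj t w

instance (n c m : ℕ) (u w : Fin n) : Decidable (FullPair n c m u w) := by
  unfold FullPair; infer_instance

def CutA (n c m : ℕ) : Prop :=
  ∃ v : Fin n, m.testBit v = false ∧ (Finset.univ.filter fun w => (LG n c).Adj v w).card = 3 ∧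
    ∀ w, (LG n c).Adj v w → m.testBit w = true

instance (n c m : ℕ) : Decidable (CutA n c m) := by
  unfold CutA; infer_instance

def CutB (n c m : ℕ) : Prop :=
  (Finset.univ.filter fun i : Fin n => m.testBit i = true).card = 4 ∧
  ∃ u₁ w₁, FullPair n c m u₁ w₁ ∧ ∃ u₂ w₂, FullPair n c m u₂ w₂ ∧
    (u₁ ≠ u₂ ∧ u₁ ≠ w₂ ∧ w₁ ≠ u₂ ∧ w₁ ≠ w₂) ∧ ∃ u₃ w₃, FullPair n c m u₃ w₃ ∧
    (u₁ ≠ u₃ ∧ u₁ ≠ w₃ ∧ w₁ ≠ u₃ ∧ w₁ ≠ w₃) ∧ (u₂ ≠ u₃ ∧ u₂ ≠ w₃ ∧ w₂ ≠ u₃ ∧ w₂ ≠ w₃)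

instance (n c m : ℕ) : Decidable (CutB n c m) := by
  unfold CutB; infer_instance

/-- there is a vertex outside `m` from which bfs reaches everything outside `m` -/
def CutConn (n c m : ℕ) : Prop :=
  ∃ v : Fin n, m.testBit v = false ∧
    bfs n c (2 ^ n - 1 - m) 5 (2 ^ v.val) = 2 ^ n - 1 - m

instance (n c m : ℕ) : Decidable (CutConn n c m) := by
  unfold CutConn; infer_instance

theorem cut_check : ∀ d ∈ petData, ∀ m < 2 ^ d.1,
    (5 ≤ (Finset.univ.filter fun i : Fin d.1 => m.testBit i = true).card) ∨
    (CutA d.1 d.2 m ∨ CutConn d.1 d.2 m) ∨ CutB d.1 d.2 m := by decide +kernel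

theorem foldr_bits (n c s : ℕ) (l : List ℕ) (j : ℕ)
    (h : (l.foldr (fun i r => if s.testBit i then Nat.lor (c >>> (i * n)) r else r) 0).testBit j
      = true) : ∃ i ∈ l, s.testBit i = true ∧ c.testBit (i * n + j) = true := by
  induction l with
  | nil => simp at h
  | cons a l ih =>
    rw [List.foldr_cons] at h
    by_cases ha : s.testBit a = true
    · rw [if_pos ha] at h
      have h' := Nat.testBit_or (c >>> (a * n))
        (l.foldr (fun i r => if s.testBit i then Nat.lor (c >>> (i * n)) r else r) 0) j
      change (Nat.lor _ _).testBit j = _ at h'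
      rw [h', Nat.testBit_shiftRight, Bool.or_eq_true] at h
      rcases h with h | h
      · exact ⟨a, by simp, ha, h⟩
      · obtain ⟨i, hi, h1⟩ := ih h
        exact ⟨i, List.mem_cons_of_mem _ hi, h1⟩
    · rw [if_neg ha] at h
      obtain ⟨i, hi, h1⟩ := ih h
      exact ⟨i, List.mem_cons_of_mem _ hi, h1⟩

theorem bfs_sound {n c m : ℕ} (hm : m < 2 ^ n) (Q : Fin n → Prop)
    (hQ : ∀ u w : Fin n, m.testBit u = false → m.testBit w = false → (LG n c).Adj u w → Q u → Q w)
    (k s : ℕ) (hs : ∀ j, s.testBit j = true → ∃ h : j < n, m.testBit j = false ∧ Q ⟨j, h⟩) :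
    ∀ j, (bfs n c (2 ^ n - 1 - m) k s).testBit j = true →
      ∃ h : j < n, m.testBit j = false ∧ Q ⟨j, h⟩ := by
  induction k with
  | zero => exact hs
  | succ k ih =>
    intro j hj
    rw [bfs, bfsStep] at hj
    set s' := bfs n c (2 ^ n - 1 - m) k s with hs'
    have h' := Nat.testBit_or s' (Nat.land (2 ^ n - 1 - m) ((List.range n).foldr
      (fun i r => if s'.testBit i then Nat.lor (c >>> (i * n)) r else r) 0)) j
    change (Nat.lor _ _).testBit j = _ at h'
    rw [h', Bool.or_eq_true] at hj
    rcases hj with hj | hj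
    · exact ih j hj
    · have h' := Nat.testBit_and (2 ^ n - 1 - m) ((List.range n).foldr
        (fun i r => if s'.testBit i then Nat.lor (c >>> (i * n)) r else r) 0) j
      change (Nat.land _ _).testBit j = _ at h'
      rw [h', Bool.and_eq_true] at hj
      obtain ⟨h1, h2⟩ := hj
      rw [show 2 ^ n - 1 - m = 2 ^ n - (m + 1) by omega, Nat.testBit_two_pow_sub_succ hm] at h1
      simp only [Bool.and_eq_true, decide_eq_true_eq, Bool.not_eq_true'] at h1
      obtain ⟨i, -, hi, hc⟩ := foldr_bits n c s' _ j h2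
      obtain ⟨hin, him, hiq⟩ := ih i hi
      refine ⟨h1.1, h1.2, ?_⟩
      by_cases hij : i = j
      · subst hij; exact hiq
      · exact hQ ⟨i, hin⟩ ⟨j, h1.1⟩ him h1.2 ⟨by simpa using hij, Or.inl hc⟩ hiq

theorem cutConn_sound {n c m : ℕ} (hm : m < 2 ^ n) (h : CutConn n c m) (Q : Fin n → Prop)
    (hQ : ∀ u w : Fin n, m.testBit u = false → m.testBit w = false → (LG n c).Adj u w →
      (Q u ↔ Q w)) (a b : Fin n) (ha : m.testBit a = false) (hb : m.testBit b = false)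
    (hQa : Q a) : Q b := by
  obtain ⟨v, hv, hbfs⟩ := h
  have key : ∀ P : Fin n → Prop, (∀ u w : Fin n, m.testBit u = false → m.testBit w = false →
      (LG n c).Adj u w → P u → P w) → P v → ∀ b : Fin n, m.testBit b = false → P b := by
    intro P hP hPv b hb
    have := bfs_sound hm P hP 5 (2 ^ v.val) (by
      intro j hj
      rw [Nat.testBit_two_pow] at hj
      have hj : v.val = j := by simpa using hj
      subst hj
      exact ⟨v.2, hv, hPv⟩) b (by
      rw [hbfs, show 2 ^ n - 1 - m = 2 ^ n - (m + 1) by omega, Nat.testBit_two_pow_sub_succ hm]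
      simp [hb])
    exact this.2.2
  by_contra hQb
  by_cases hQv : Q v
  · exact hQb (key Q (fun u w h1 h2 h3 => (hQ u w h1 h2 h3).1) hQv b hb)
  · exact key (fun u => ¬ Q u) (fun u w h1 h2 h3 h4 h5 => h4 ((hQ u w h1 h2 h3).2 h5)) hQv a ha hQa

/-! ### Classification of the Petersen family -/

theorem triangleY_some {V : Type} (G : SimpleGraph V) (a b c p q : V) :
    (triangleY G a b c).Adj (some p) (some q) ↔
      G.Adj p q ∧ ¬ ((p = a ∨ p = b ∨ p = c) ∧ (q = a ∨ q = b ∨ q = c)) := by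
  have hmap : (SimpleGraph.map Function.Embedding.some
      (G.deleteEdges {s(a, b), s(b, c), s(a, c)})).Adj (some p) (some q) ↔
      (G.deleteEdges {s(a, b), s(b, c), s(a, c)}).Adj p q :=
    SimpleGraph.map_adj_apply (f := Function.Embedding.some)
  have hne := fun h : G.Adj p q => h.ne
  rw [triangleY, SimpleGraph.sup_adj, hmap]
  simp only [SimpleGraph.deleteEdges_adj,
    SimpleGraph.fromEdgeSet_adj, Set.mem_insert_iff, Set.mem_singleton_iff, Sym2.eq_iff,
    reduceCtorEq, false_and, and_false, or_false]
  constructor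
  · rintro ⟨h1, h2⟩
    refine ⟨h1, ?_⟩
    have := h1.ne
    grind
  · rintro ⟨h1, h2⟩
    refine ⟨h1, ?_⟩
    grind

theorem triangleY_none {V : Type} (G : SimpleGraph V) (a b c p : V) :
    (triangleY G a b c).Adj none (some p) ↔ (p = a ∨ p = b ∨ p = c) := by
  have hmap : ¬ (SimpleGraph.map Function.Embedding.some
      (G.deleteEdges {s(a, b), s(b, c), s(a, c)})).Adj none (some p) := by
    rintro ⟨-, u, v, -, h, -⟩
    cases h
  rw [triangleY, SimpleGraph.sup_adj]
  simp only [hmap, false_or]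
  simp

theorem triangleY_none' {V : Type} (G : SimpleGraph V) (a b c p : V) :
    (triangleY G a b c).Adj (some p) none ↔ (p = a ∨ p = b ∨ p = c) := by
  rw [SimpleGraph.adj_comm, triangleY_none]

theorem triangleY_iso {V W : Type} {G : SimpleGraph V} {H : SimpleGraph W} (e : G ≃g H)
    {a b c : V} {a' b' c' : W}
    (h : ∀ p, (e p = a' ∨ e p = b' ∨ e p = c') ↔ (p = a ∨ p = b ∨ p = c)) :
    ∃ e' : triangleY G a b c ≃g triangleY H a' b' c', e' none = none := by
  refine ⟨⟨Equiv.optionCongr e.toEquiv, ?_⟩, rfl⟩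
  intro p q
  rcases p with _ | p <;> rcases q with _ | q
  · simp
  · simp [triangleY_none]; exact h q
  · simp [triangleY_none']; exact h p
  · simp only [Equiv.optionCongr_apply, Option.map_some, triangleY_some]
    have h1 := h p
    have h2 := h q
    have h3 : H.Adj (e p) (e q) ↔ G.Adj p q := e.map_adj_iff
    change H.Adj (e p) (e q) ∧ ¬ ((e p = a' ∨ e p = b' ∨ e p = c') ∧
      (e q = a' ∨ e q = b' ∨ e q = c')) ↔ _
    rw [h1, h2, h3]

theorem triangleY_iso_inv {V W : Type} {G : SimpleGraph V} {H : SimpleGraph W}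
    {a b c : V} {a' b' c' : W} (hab : G.Adj a b) (hbc : G.Adj b c) (hac : G.Adj a c)
    (hab' : H.Adj a' b') (hbc' : H.Adj b' c') (hac' : H.Adj a' c')
    (e : triangleY G a b c ≃g triangleY H a' b' c') (he : e none = none) :
    Nonempty (G ≃g H) := by
  have hs : ∀ p, some (Equiv.removeNone e.toEquiv p) = e (some p) := by
    intro p
    apply Equiv.removeNone_some
    have : e (some p) ≠ none := by
      rw [← he]; simp
    exact ⟨(e (some p)).get (Option.isSome_iff_ne_none.2 this), by simp⟩
  have hT : ∀ p, (Equiv.removeNone e.toEquiv p = a' ∨ Equiv.removeNone e.toEquiv p = b' ∨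
      Equiv.removeNone e.toEquiv p = c') ↔ (p = a ∨ p = b ∨ p = c) := by
    intro p
    rw [← triangleY_none H, ← triangleY_none G, hs]
    conv_lhs => rw [← he]
    exact e.map_adj_iff
  refine ⟨⟨Equiv.removeNone e.toEquiv, ?_⟩⟩
  intro p q
  have h1 : (triangleY H a' b' c').Adj (e (some p)) (e (some q)) ↔ _ := e.map_adj_iff
  rw [← hs, ← hs, triangleY_some, triangleY_some, hT, hT] at h1
  by_cases h2 : (p = a ∨ p = b ∨ p = c) ∧ (q = a ∨ q = b ∨ q = c)
  · have h3 := (hT p).2 h2.1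
    have h4 := (hT q).2 h2.2
    have h5 : Equiv.removeNone e.toEquiv p = Equiv.removeNone e.toEquiv q ↔ p = q :=
      (Equiv.removeNone e.toEquiv).injective.eq_iff
    have gs := fun u v => (G.adj_comm u v).1
    have hs := fun u v => (H.adj_comm u v).1
    have g1 : G.Adj p q ↔ p ≠ q := by
      constructor
      · exact fun h => h.ne
      · grind
    have g2 : H.Adj (Equiv.removeNone e.toEquiv p) (Equiv.removeNone e.toEquiv q) ↔
        Equiv.removeNone e.toEquiv p ≠ Equiv.removeNone e.toEquiv q := by
      constructor
      · exact fun h => h.ne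
      · generalize Equiv.removeNone e.toEquiv p = p' at *
        generalize Equiv.removeNone e.toEquiv q = q' at *
        grind
    rw [g1, g2, Ne, h5]
  · exact ⟨fun hp => (h1.1 ⟨hp, h2⟩).1, fun hq => (h1.2 ⟨hq, h2⟩).1⟩

theorem PEnt.iso (e : PEnt) (he : e.Valid) : ∃ a b c : Fin e.n,
    (LG e.n e.c).Adj a b ∧ (LG e.n e.c).Adj b c ∧ (LG e.n e.c).Adj a c ∧
    (∀ p : Fin e.n, e.inT p ↔ (p = a ∨ p = b ∨ p = c)) ∧
    ∃ φ : triangleY (LG e.n e.c) a b c ≃g LG (e.n + 1) e.d, φ none = e.map e.n := by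
  obtain ⟨-, -, ⟨a, b, c, ha, hb, hc, hab, hbc, hac⟩, h1, h2⟩ := he
  have hT : ∀ p : Fin e.n, e.inT p ↔ (p = a ∨ p = b ∨ p = c) := by
    intro p
    simp [PEnt.inT, ← ha, ← hb, ← hc, Fin.ext_iff]
  refine ⟨a, b, c, hab, hbc, hac, hT, ?_⟩
  let τ : Option (Fin e.n) → Fin (e.n + 1) := fun o => o.elim (e.map e.n) (fun p => e.map p)
  have hτ : Function.Bijective τ := by
    rw [Fintype.bijective_iff_injective_and_card]
    refine ⟨?_, by simp⟩
    rintro (_ | p) (_ | q) hpq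
    · rfl
    · exact absurd hpq (h2 q).1
    · exact absurd hpq.symm (h2 p).1
    · exact congrArg some ((h1 p q).1 hpq)
  refine ⟨⟨Equiv.ofBijective τ hτ, ?_⟩, rfl⟩
  rintro (_ | p) (_ | q)
  · simp
  · change (LG (e.n + 1) e.d).Adj (e.map e.n) (e.map q) ↔ _
    rw [(h2 q).2, triangleY_none, hT]
  · change (LG (e.n + 1) e.d).Adj (e.map p) (e.map e.n) ↔ _
    rw [SimpleGraph.adj_comm, (h2 p).2, triangleY_none', hT]
  · change (LG (e.n + 1) e.d).Adj (e.map p) (e.map q) ↔ _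
    rw [(h1 p q).2, triangleY_some, hT, hT]

/-- A degree three vertex of one of the seven graphs comes from a `∇Y`-move. -/
theorem petY (n c : ℕ) (hd : (n, c) ∈ petData) (v : Fin n)
    (hv : (Finset.univ.filter fun w => (LG n c).Adj v w).card = 3) :
    ∃ n' c', n' + 1 = n ∧ (n', c') ∈ petData ∧ ∃ a b d : Fin n',
      (LG n' c').Adj a b ∧ (LG n' c').Adj b d ∧ (LG n' c').Adj a d ∧
      ∃ φ : triangleY (LG n' c') a b d ≃g LG n c, φ none = v := by
  obtain ⟨e, he, h1, h2, h3⟩ := petTable_Y (n, c) hd v hv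
  have hval := petTable_valid e he
  obtain ⟨a, b, d, hab, hbd, had, -, φ, hφ⟩ := e.iso hval
  have hmem := hval.1
  obtain ⟨en, ec, eu, ev, ew, ed, es⟩ := e
  dsimp only at *
  subst h1 h2
  exact ⟨en, ec, rfl, hmem, a, b, d, hab, hbd, had, φ, by rw [hφ]; exact Fin.ext h3⟩

theorem classify {V : Type} {H : SimpleGraph V} (h : IsPetersenFamily H) :
    ∃ d ∈ petData, Nonempty (H ≃g LG d.1 d.2) := by
  induction h with
  | k6 =>
    refine ⟨(6, 34089189246), by decide, ⟨⟨Equiv.refl _, ?_⟩⟩⟩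
    intro a b
    revert a b
    decide +kernel
  | @deltaY V G a b c _ hab hbc hac ih =>
    obtain ⟨⟨n, k⟩, hd, ⟨φ⟩⟩ := ih
    obtain ⟨e, he, h1, h2, h3⟩ := petTable_tri (n, k) hd (φ a) (φ b) (φ c)
      (φ.map_adj_iff.2 hab) (φ.map_adj_iff.2 hbc) (φ.map_adj_iff.2 hac)
    have hval := petTable_valid e he
    obtain ⟨a', b', c', -, -, -, hT, ψ, -⟩ := e.iso hval
    have hmem := hval.2.1
    obtain ⟨en, ec, eu, ev, ew, ed, es⟩ := e
    dsimp only at *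
    subst h1 h2
    refine ⟨_, hmem, ?_⟩
    obtain ⟨χ, -⟩ := triangleY_iso (a := a) (b := b) (c := c) (a' := a') (b' := b') (c' := c') φ (by
      intro p
      rw [← hT, ← h3]
      simp)
    exact ⟨χ.trans ψ⟩
  | @yDelta V G a b c _ hab hbc hac ih =>
    obtain ⟨⟨n, k⟩, hd, ⟨φ⟩⟩ := ih
    have hcard : (Finset.univ.filter fun w => (LG n k).Adj (φ none) w).card = 3 := by
      rw [Finset.card_eq_three]
      refine ⟨φ (some a), φ (some b), φ (some c), ?_, ?_, ?_, ?_⟩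
      · simpa using hab.ne
      · simpa using hac.ne
      · simpa using hbc.ne
      · ext w
        obtain ⟨o, rfl⟩ := φ.surjective w
        simp only [Finset.mem_filter, Finset.mem_univ, true_and, φ.map_adj_iff,
          Finset.mem_insert, Finset.mem_singleton, EmbeddingLike.apply_eq_iff_eq]
        rcases o with _ | p
        · simp
        · simp [triangleY_none]
    obtain ⟨n', c', -, hmem, a', b', d', h1, h2, h3, ψ, hψ⟩ := petY n k hd _ hcard
    refine ⟨_, hmem, ?_⟩
    refine triangleY_iso_inv hab hbc hac h1 h2 h3 (φ.trans ψ.symm) ?_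
    simp [← hψ]
  | @iso V W G H _ e ih =>
    obtain ⟨d, hd, ⟨φ⟩⟩ := ih
    exact ⟨d, hd, ⟨e.symm.trans φ⟩⟩

theorem pet_of_entry (e : PEnt) (he : e ∈ petTable) (h : IsPetersenFamily (LG e.n e.c)) :
    IsPetersenFamily (LG (e.n + 1) e.d) := by
  obtain ⟨a, b, c, h1, h2, h3, -, φ, -⟩ := e.iso (petTable_valid e he)
  exact (h.deltaY h1 h2 h3).iso φ

theorem pet_of_entry' (e : PEnt) (he : e ∈ petTable) (h : IsPetersenFamily (LG (e.n + 1) e.d)) :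
    IsPetersenFamily (LG e.n e.c) := by
  obtain ⟨a, b, c, h1, h2, h3, -, φ, -⟩ := e.iso (petTable_valid e he)
  exact (h.iso φ.symm).yDelta h1 h2 h3

/-- `K₃,₃,₁` is in the Petersen family. -/
theorem pet_K331 : IsPetersenFamily (LG 7 266764620717628) := by
  have h0 : IsPetersenFamily (LG 6 34089189246) := by
    refine IsPetersenFamily.k6.iso ⟨Equiv.refl _, ?_⟩
    intro a b
    revert a b
    decide +kernel
  have h1 := pet_of_entry ⟨6, 34089189246, 0, 1, 2, 31864211258488, [0, 1, 2, 3, 4, 5, 6]⟩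
    (by simp [petTable]) h0
  have h2 := pet_of_entry ⟨7, 31864211258488, 0, 3, 4, 1803444976403118304,
    [0, 1, 2, 3, 4, 5, 6, 7]⟩ (by simp [petTable]) h1
  exact pet_of_entry' ⟨7, 266764620717628, 4, 5, 6, 1803444976403118304,
    [1, 2, 3, 4, 5, 6, 7, 0]⟩ (by simp [petTable]) h2

/-! ### Connected sets and minor models -/

/-- one step inside `X` -/
def StepIn {V : Type} (G : SimpleGraph V) (X : Set V) (a b : V) : Prop :=
  a ∈ X ∧ b ∈ X ∧ G.Adj a b

/-- reachability inside `X` -/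
def RIn {V : Type} (G : SimpleGraph V) (X : Set V) : V → V → Prop :=
  Relation.ReflTransGen (StepIn G X)

/-- `X` induces a connected subgraph -/
def Conn {V : Type} (G : SimpleGraph V) (X : Set V) : Prop :=
  X.Nonempty ∧ ∀ a ∈ X, ∀ b ∈ X, RIn G X a b

/-- there is an edge between `X` and `Y` -/
def Touch {V : Type} (G : SimpleGraph V) (X Y : Set V) : Prop := ∃ a ∈ X, ∃ b ∈ Y, G.Adj a b

theorem Touch.symm {V : Type} {G : SimpleGraph V} {X Y : Set V} (h : Touch G X Y) :
    Touch G Y X := by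
  obtain ⟨a, ha, b, hb, h⟩ := h
  exact ⟨b, hb, a, ha, h.symm⟩

theorem Touch.mono {V : Type} {G : SimpleGraph V} {X Y X' Y' : Set V} (h : Touch G X Y)
    (hX : X ⊆ X') (hY : Y ⊆ Y') : Touch G X' Y' := by
  obtain ⟨a, ha, b, hb, h⟩ := h
  exact ⟨a, hX ha, b, hY hb, h⟩

theorem RIn.symm {V : Type} {G : SimpleGraph V} {X : Set V} {a b : V} (h : RIn G X a b) :
    RIn G X b a := by
  induction h with
  | refl => exact Relation.ReflTransGen.refl
  | tail _ h2 ih => exact Relation.ReflTransGen.head ⟨h2.2.1, h2.1, h2.2.2.symm⟩ ih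

theorem RIn.mono {V : Type} {G : SimpleGraph V} {X Y : Set V} {a b : V} (h : RIn G X a b)
    (hXY : X ⊆ Y) : RIn G Y a b := by
  induction h with
  | refl => exact Relation.ReflTransGen.refl
  | tail _ h2 ih => exact Relation.ReflTransGen.tail ih ⟨hXY h2.1, hXY h2.2.1, h2.2.2⟩

theorem RIn.single {V : Type} {G : SimpleGraph V} {X : Set V} {a b : V} (ha : a ∈ X) (hb : b ∈ X)
    (h : G.Adj a b) : RIn G X a b := Relation.ReflTransGen.single ⟨ha, hb, h⟩

theorem RIn.map {V U : Type} {G : SimpleGraph V} {Q : SimpleGraph U} {X : Set V} {Y : Set U}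
    (r : V → U) (h : ∀ a ∈ X, ∀ b ∈ X, G.Adj a b → RIn Q Y (r a) (r b)) {a b : V}
    (hab : RIn G X a b) : RIn Q Y (r a) (r b) := by
  induction hab with
  | refl => exact Relation.ReflTransGen.refl
  | tail _ h2 ih => exact ih.trans (h _ h2.1 _ h2.2.1 h2.2.2)

theorem RIn.closed {V : Type} {G : SimpleGraph V} {X Z : Set V} {a b : V}
    (hZ : ∀ p ∈ X, ∀ q ∈ X, G.Adj p q → p ∈ Z → q ∈ Z) (ha : a ∈ Z) (h : RIn G X a b) : b ∈ Z := by
  induction h with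
  | refl => exact ha
  | tail _ h2 ih => exact hZ _ h2.1 _ h2.2.1 h2.2.2 ih

theorem conn_iff {V : Type} {G : SimpleGraph V} {X : Set V} :
    (G.induce X).Connected ↔ Conn G X := by
  constructor
  · intro h
    obtain ⟨⟨x, hx⟩⟩ := h.nonempty
    refine ⟨⟨x, hx⟩, ?_⟩
    intro a ha b hb
    have h1 := h.preconnected ⟨a, ha⟩ ⟨b, hb⟩
    rw [SimpleGraph.reachable_iff_reflTransGen] at h1
    have : ∀ p q : X, Relation.ReflTransGen (G.induce X).Adj p q → RIn G X p q := by
      intro p q h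
      induction h with
      | refl => exact Relation.ReflTransGen.refl
      | tail _ h2 ih => exact ih.tail ⟨Subtype.prop _, Subtype.prop _, h2⟩
    exact this _ _ h1
  · rintro ⟨⟨x, hx⟩, h⟩
    have : Nonempty X := ⟨⟨x, hx⟩⟩
    refine SimpleGraph.Connected.mk ?_
    rintro ⟨a, ha⟩ ⟨b, hb⟩
    have h1 := h a ha b hb
    rw [SimpleGraph.reachable_iff_reflTransGen]
    have : ∀ q, RIn G X a q → ∀ hq : q ∈ X,
        Relation.ReflTransGen (G.induce X).Adj ⟨a, ha⟩ ⟨q, hq⟩ := by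
      intro q h
      induction h with
      | refl => intro _; exact Relation.ReflTransGen.refl
      | tail _ h2 ih => exact fun hq => (ih h2.1).tail h2.2.2
    exact this b h1 hb

theorem Conn.singleton {V : Type} (G : SimpleGraph V) (v : V) : Conn G {v} := by
  refine ⟨⟨v, rfl⟩, ?_⟩
  rintro a rfl b rfl
  exact Relation.ReflTransGen.refl

theorem Conn.of_base {V : Type} {G : SimpleGraph V} {X : Set V} (v : V) (hv : v ∈ X)
    (h : ∀ a ∈ X, RIn G X v a) : Conn G X :=
  ⟨⟨v, hv⟩, fun a ha b hb => (h a ha).symm.trans (h b hb)⟩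

theorem Conn.union {V : Type} {G : SimpleGraph V} {X Y : Set V} (hX : Conn G X) (hY : Conn G Y)
    (h : Touch G X Y) : Conn G (X ∪ Y) := by
  obtain ⟨a, ha, b, hb, hab⟩ := h
  refine Conn.of_base a (Or.inl ha) ?_
  rintro c (hc | hc)
  · exact (hX.2 a ha c hc).mono Set.subset_union_left
  · have h1 : RIn G (X ∪ Y) a b := RIn.single (Or.inl ha) (Or.inr hb) hab
    exact h1.trans ((hY.2 b hb c hc).mono Set.subset_union_right)

theorem Conn.insert {V : Type} {G : SimpleGraph V} {X : Set V} (hX : Conn G X) {p d : V}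
    (hd : d ∈ X) (h : G.Adj d p) : Conn G (X ∪ {p}) :=
  hX.union (Conn.singleton G p) ⟨d, hd, p, rfl, h⟩

theorem Conn.closed {V : Type} {G : SimpleGraph V} {X Z : Set V} (hX : Conn G X)
    (hZ : ∀ p ∈ X, ∀ q ∈ X, G.Adj p q → p ∈ Z → q ∈ Z) {a : V} (ha : a ∈ X) (haZ : a ∈ Z) :
    X ⊆ Z := fun b hb => RIn.closed hZ haZ (hX.2 a ha b hb)

theorem Conn.mono_graph {V : Type} {G G' : SimpleGraph V} {X : Set V} (hX : Conn G X)
    (h : ∀ a ∈ X, ∀ b ∈ X, G.Adj a b → G'.Adj a b) : Conn G' X :=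
  ⟨hX.1, fun a ha b hb => RIn.map id (fun p hp q hq hpq => RIn.single hp hq (h p hp q hq hpq))
    (hX.2 a ha b hb)⟩

/-- a minor model of `H` in `G` -/
structure Model {W V : Type} (H : SimpleGraph W) (G : SimpleGraph V) (f : W → Set V) : Prop where
  conn : ∀ w, Conn G (f w)
  disj : ∀ w₁ w₂ v, v ∈ f w₁ → v ∈ f w₂ → w₁ = w₂
  adj : ∀ w₁ w₂, H.Adj w₁ w₂ → Touch G (f w₁) (f w₂)

theorem isMinor_iff {W V : Type} {H : SimpleGraph W} {G : SimpleGraph V} :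
    IsMinor H G ↔ ∃ f, Model H G f := by
  constructor
  · rintro ⟨f, h1, h2, h3, h4⟩
    refine ⟨f, ⟨fun w => conn_iff.1 (h2 w), ?_, fun w₁ w₂ h => h4 h⟩⟩
    intro w₁ w₂ v hv1 hv2
    by_contra hne
    exact Set.disjoint_left.1 (h3 hne) hv1 hv2
  · rintro ⟨f, h⟩
    refine ⟨f, fun w => (h.conn w).1, fun w => conn_iff.2 (h.conn w), ?_, fun w₁ w₂ h' =>
      h.adj w₁ w₂ h'⟩
    intro w₁ w₂ hne
    exact Set.disjoint_left.2 fun v hv1 hv2 => hne (h.disj w₁ w₂ v hv1 hv2)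

theorem Model.comp_inj {W U V : Type} {H : SimpleGraph W} {H' : SimpleGraph U} {G : SimpleGraph V}
    {f : W → Set V} (h : Model H G f) (φ : U → W) (hφ : Function.Injective φ)
    (hadj : ∀ a b, H'.Adj a b → H.Adj (φ a) (φ b) ∨ Touch G (f (φ a)) (f (φ b))) :
    Model H' G (fun u => f (φ u)) :=
  ⟨fun _ => h.conn _, fun _ _ v h1 h2 => hφ (h.disj _ _ v h1 h2),
    fun a b hab => (hadj a b hab).elim (fun h' => h.adj _ _ h') id⟩

/-! ### Clique sums over `K₄` -/

/-- `G` is a clique sum over the `K₄` with vertices `s i`, with connected sides `A` and `B` -/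
structure CS {V : Type} (G : SimpleGraph V) (s : Fin 4 → V) (A B : Set V) : Prop where
  inj : Function.Injective s
  cl : ∀ i j, i ≠ j → G.Adj (s i) (s j)
  cov : ∀ v, (∃ i, v = s i) ∨ v ∈ A ∨ v ∈ B
  sA : ∀ i, s i ∉ A
  sB : ∀ i, s i ∉ B
  AB : ∀ v, v ∈ A → v ∉ B
  noE : ∀ a ∈ A, ∀ b ∈ B, ¬ G.Adj a b
  cA : Conn G A
  cB : Conn G B

theorem CS.symm {V : Type} {G : SimpleGraph V} {s : Fin 4 → V} {A B : Set V} (h : CS G s A B) :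
    CS G s B A :=
  ⟨h.inj, h.cl, fun v => (h.cov v).imp_right Or.symm, h.sB, h.sA, fun v h1 h2 => h.AB v h2 h1,
    fun a ha b hb hab => h.noE b hb a ha hab.symm, h.cB, h.cA⟩

theorem CS.trich {V : Type} {G : SimpleGraph V} {s : Fin 4 → V} {A B : Set V} (h : CS G s A B)
    {X : Set V} (hX : Conn G X) : (∃ i, s i ∈ X) ∨ X ⊆ A ∨ X ⊆ B := by
  by_cases hs : ∃ i, s i ∈ X
  · exact Or.inl hs
  · right
    push Not at hs
    obtain ⟨v, hv⟩ := hX.1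
    have hside : ∀ p ∈ X, p ∈ A ∨ p ∈ B := by
      intro p hp
      rcases h.cov p with ⟨i, rfl⟩ | hp'
      · exact absurd hp (hs i)
      · exact hp'
    rcases hside v hv with hvA | hvB
    · left
      refine hX.closed ?_ hv hvA
      intro p hp q hq hpq hpA
      rcases hside q hq with hq' | hq'
      · exact hq'
      · exact absurd hpq (h.noE p hpA q hq')
    · right
      refine hX.closed ?_ hv hvB
      intro p hp q hq hpq hpB
      rcases hside q hq with hq' | hq'
      · exact absurd hpq.symm (h.noE q hq' p hpB)
      · exact hq'

theorem CS.nbrA {V : Type} {G : SimpleGraph V} {s : Fin 4 → V} {A B : Set V} (h : CS G s A B)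
    {p q : V} (hp : p ∈ A) (hpq : G.Adj p q) (hq : q ∉ A) : ∃ i, q = s i := by
  rcases h.cov q with h1 | h1 | h1
  · exact h1
  · exact absurd h1 hq
  · exact absurd hpq (h.noE p hp q h1)

theorem CS.retract {V : Type} {G : SimpleGraph V} {s : Fin 4 → V} {A B : Set V} (h : CS G s A B)
    {X : Set V} (hX : Conn G X) (i : Fin 4) (hi : s i ∈ X) : Conn G (X \ A) := by
  classical
  refine Conn.of_base (s i) ⟨hi, h.sA i⟩ ?_
  intro a ha
  have := RIn.map (Q := G) (Y := X \ A) (fun v => if v ∈ A then s i else v) ?_ (hX.2 _ hi a ha.1)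
  · simpa [h.sA i, ha.2] using this
  · intro p hp q hq hpq
    have key : ∀ q ∈ X, q ∉ A → (∃ j, q = s j) → RIn G (X \ A) (s i) q := by
      rintro q hq hqA ⟨j, rfl⟩
      by_cases hij : i = j
      · subst hij; exact Relation.ReflTransGen.refl
      · exact RIn.single ⟨hi, h.sA i⟩ ⟨hq, hqA⟩ (h.cl i j hij)
    by_cases hpA : p ∈ A <;> by_cases hqA : q ∈ A
    · simp only [hpA, hqA, if_true]; exact Relation.ReflTransGen.refl
    · simp only [hpA, hqA, if_true, if_false]
      exact key q hq hqA (h.nbrA hpA hpq hqA)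
    · simp only [hpA, hqA, if_true, if_false]
      exact (key p hp hpA (h.nbrA hqA hpq.symm hpA)).symm
    · simp only [hpA, hqA, if_false]
      exact RIn.single ⟨hp, hpA⟩ ⟨hq, hqA⟩ hpq

theorem CS.touch {V : Type} {G : SimpleGraph V} {s : Fin 4 → V} {A B : Set V} (h : CS G s A B)
    {X Y : Set V} (hX : ∃ i, s i ∈ X) (hY : ∃ i, s i ∈ Y) (hd : ∀ v, v ∈ X → v ∉ Y) :
    Touch G X Y := by
  obtain ⟨i, hi⟩ := hX
  obtain ⟨j, hj⟩ := hY
  refine ⟨_, hi, _, hj, h.cl i j ?_⟩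
  rintro rfl
  exact hd _ hi hj

theorem CS.touch_diff {V : Type} {G : SimpleGraph V} {s : Fin 4 → V} {A B : Set V} (h : CS G s A B)
    {X Y : Set V} (hX : (∃ i, s i ∈ X) ∨ X ⊆ B) (hY : (∃ i, s i ∈ Y) ∨ Y ⊆ B)
    (hd : ∀ v, v ∈ X → v ∉ Y) (ht : Touch G X Y) : Touch G (X \ A) (Y \ A) := by
  by_cases hs : (∃ i, s i ∈ X) ∧ (∃ i, s i ∈ Y)
  · refine h.touch ?_ ?_ (fun v h1 h2 => hd v h1.1 h2.1)
    · obtain ⟨i, hi⟩ := hs.1; exact ⟨i, hi, h.sA i⟩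
    · obtain ⟨i, hi⟩ := hs.2; exact ⟨i, hi, h.sA i⟩
  · obtain ⟨a, ha, b, hb, hab⟩ := ht
    refine ⟨a, ⟨ha, ?_⟩, b, ⟨hb, ?_⟩, hab⟩
    · intro haA
      rcases hX with hX | hX
      · rcases hY with hY | hY
        · exact hs ⟨hX, hY⟩
        · exact h.noE a haA b (hY hb) hab
      · exact h.AB a haA (hX ha)
    · intro hbA
      rcases hY with hY | hY
      · rcases hX with hX | hX
        · exact hs ⟨hX, hY⟩
        · exact h.noE b hbA a (hX ha) hab.symm
      · exact h.AB b hbA (hY hb)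

theorem CS.model_diff {V W : Type} {G : SimpleGraph V} {s : Fin 4 → V} {A B : Set V}
    (h : CS G s A B) {H : SimpleGraph W} {f : W → Set V} (hf : Model H G f)
    (hA : ∀ w, ¬ f w ⊆ A) : Model H G (fun w => f w \ A) := by
  have hcase : ∀ w, (∃ i, s i ∈ f w) ∨ f w ⊆ B := by
    intro w
    rcases h.trich (hf.conn w) with h1 | h1 | h1
    · exact Or.inl h1
    · exact absurd h1 (hA w)
    · exact Or.inr h1
  refine ⟨?_, fun w₁ w₂ v h1 h2 => hf.disj w₁ w₂ v h1.1 h2.1, ?_⟩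
  · intro w
    rcases hcase w with ⟨i, hi⟩ | h1
    · exact h.retract (hf.conn w) i hi
    · have : f w \ A = f w := by
        ext v
        exact ⟨fun hv => hv.1, fun hv => ⟨hv, fun hvA => h.AB v hvA (h1 hv)⟩⟩
      rw [this]; exact hf.conn w
  · intro w₁ w₂ hadj
    refine h.touch_diff (hcase w₁) (hcase w₂) ?_ (hf.adj _ _ hadj)
    intro v h1 h2
    have := hf.disj _ _ v h1 h2
    subst this
    exact hadj.ne rfl

/-- there is a Petersen family minor model avoiding `A` -/
def GoodSide {V : Type} (G : SimpleGraph V) (A : Set V) : Prop :=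
  ∃ (W : Type) (H : SimpleGraph W) (f : W → Set V), IsPetersenFamily H ∧ Model H G f ∧
    ∀ w v, v ∈ f w → v ∉ A

theorem model_fin {n : ℕ} {V : Type} {G : SimpleGraph V} {H : SimpleGraph (Fin n)}
    {f : Fin n → Set V} (hc : ∀ i, Conn G (f i)) (hd : ∀ i j, i < j → ∀ v, v ∈ f i → v ∉ f j)
    (ha : ∀ i j, i < j → H.Adj i j → Touch G (f i) (f j)) : Model H G f := by
  refine ⟨hc, ?_, ?_⟩
  · intro i j v h1 h2
    rcases lt_trichotomy i j with h | h | h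
    · exact absurd h2 (hd i j h v h1)
    · exact h
    · exact absurd h1 (hd j i h v h2)
  · intro i j hij
    rcases lt_trichotomy i j with h | h | h
    · exact ha i j h hij
    · exact absurd h hij.ne
    · exact (ha j i h hij.symm).symm

theorem model_P7 {V : Type} {G : SimpleGraph V} {f : Fin 6 → Set V} {X : Set V}
    (hc : ∀ i, Conn G (f i)) (hX : Conn G X) (hd : ∀ i j, i < j → ∀ v, v ∈ f i → v ∉ f j)
    (hXd : ∀ i, ∀ v, v ∈ X → v ∉ f i)
    (ha : ∀ i j, i < j → 2 < j → Touch G (f i) (f j))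
    (h0 : Touch G X (f 0)) (h1 : Touch G X (f 1)) (h2 : Touch G X (f 2)) :
    Model (triangleY (⊤ : SimpleGraph (Fin 6)) 0 1 2) G (fun o => o.elim X f) := by
  have hm : Model ((⊤ : SimpleGraph (Fin 6)).deleteEdges {s(0, 1), s(1, 2), s(0, 2)}) G f := by
    refine model_fin hc hd ?_
    intro i j hij hadj
    refine ha i j hij ?_
    by_contra hj
    rw [SimpleGraph.deleteEdges_adj] at hadj
    apply hadj.2
    revert i j
    simp only [Set.mem_insert_iff, Set.mem_singleton_iff, Sym2.eq_iff]
    intro i j hij _ hj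
    omega
  have hX' : ∀ i : Fin 6, (i = 0 ∨ i = 1 ∨ i = 2) → Touch G X (f i) := by
    rintro i (rfl | rfl | rfl) <;> assumption
  refine ⟨?_, ?_, ?_⟩
  · rintro (_ | i)
    · exact hX
    · exact hc i
  · rintro (_ | i) (_ | j) v hv1 hv2
    · rfl
    · exact absurd hv2 (hXd j v hv1)
    · exact absurd hv1 (hXd i v hv2)
    · exact congrArg some (hm.disj i j v hv1 hv2)
  · rintro (_ | i) (_ | j) hadj
    · exact absurd rfl hadj.ne
    · rw [triangleY_none] at hadj
      exact hX' j hadj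
    · rw [triangleY_none'] at hadj
      exact (hX' i hadj).symm
    · rw [triangleY_some] at hadj
      refine hm.adj i j ?_
      rw [SimpleGraph.deleteEdges_adj]
      refine ⟨hadj.1, fun h => hadj.2 ?_⟩
      simp only [Set.mem_insert_iff, Set.mem_singleton_iff, Sym2.eq_iff] at h
      omega

theorem CS.endgame {V : Type} [Finite V] {G : SimpleGraph V} {s : Fin 4 → V} {A B : Set V}
    (h : CS G s A B) : ∀ (k : ℕ) (D E : Set V) (P : Fin 4 → Set V), Dᶜ.ncard = k →
    D ⊆ B → E ⊆ B → Conn G D → Conn G E → (∀ i, Conn G (P i)) → (∀ i, s i ∈ P i) →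
    (∀ i v, v ∈ P i → v ∉ A) → (∀ v, v ∈ D → v ∉ E) → (∀ i v, v ∈ D → v ∉ P i) →
    (∀ i v, v ∈ E → v ∉ P i) → (∀ i j, i ≠ j → ∀ v, v ∈ P i → v ∉ P j) →
    (∀ i, Touch G D (P i)) → (∀ i, Touch G E (P i)) → GoodSide G A := by
  intro k
  induction k using Nat.strong_induction_on with
  | _ k ih =>
  intro D E P hk hDB hEB hD hE hP hsP hPA hDE hDP hEP hPP tD tE
  have tPP : ∀ i j, i ≠ j → Touch G (P i) (P j) := fun i j hij =>
    ⟨_, hsP i, _, hsP j, h.cl i j hij⟩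
  have hDA : ∀ v, v ∈ D → v ∉ A := fun v hv hA => h.AB v hA (hDB hv)
  have hEA : ∀ v, v ∈ E → v ∉ A := fun v hv hA => h.AB v hA (hEB hv)
  by_cases tDE : Touch G D E
  · refine ⟨_, ⊤, ![P 0, P 1, P 2, P 3, D, E], IsPetersenFamily.k6, ?_, ?_⟩
    · refine model_fin ?_ ?_ ?_
      · intro i
        fin_cases i
        exacts [hP 0, hP 1, hP 2, hP 3, hD, hE]
      · have hPD := fun i v (h1 : v ∈ P i) (h2 : v ∈ D) => hDP i v h2 h1
        have hPE := fun i v (h1 : v ∈ P i) (h2 : v ∈ E) => hEP i v h2 h1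
        intro i j hij
        fin_cases i <;> fin_cases j <;>
          first
          | (exfalso; revert hij; decide)
          | exact hDE
          | exact hPD _
          | exact hPE _
          | exact hPP _ _ (by decide)
      · intro i j hij _
        fin_cases i <;> fin_cases j <;>
          first
          | (exfalso; revert hij; decide)
          | exact tDE
          | exact (tD _).symm
          | exact (tE _).symm
          | exact tPP _ _ (by decide)
    · intro i
      fin_cases i
      exacts [hPA 0, hPA 1, hPA 2, hPA 3, hDA, hEA]
  -- a vertex `p` of `B` next to `D`
  have hex : ∃ d ∈ D, ∃ p ∈ B, p ∉ D ∧ G.Adj d p := by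
    by_contra hno
    push Not at hno
    obtain ⟨d, hd⟩ := hD.1
    obtain ⟨e, he⟩ := hE.1
    have : B ⊆ D := h.cB.closed (fun p _ q hq hpq hpD => by
      by_contra hqD
      exact hno p hpD q hq hqD hpq) (hDB hd) hd
    exact hDE e (this (hEB he)) he
  obtain ⟨d, hd, p, hpB, hpD, hdp⟩ := hex
  have hpE : p ∉ E := fun hpE => tDE ⟨d, hd, p, hpE, hdp⟩
  have hcard : (D ∪ {p})ᶜ.ncard < k := by
    rw [← hk]
    apply Set.ncard_lt_ncard _ (Set.toFinite _)
    refine ⟨fun v hv hvD => hv (Or.inl hvD), fun hsub => ?_⟩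
    exact hsub (show p ∈ Dᶜ from hpD) (Or.inr rfl)
  have hDp : Conn G (D ∪ {p}) := hD.insert hd hdp
  have hDpB : D ∪ {p} ⊆ B := by
    rintro v (hv | rfl)
    · exact hDB hv
    · exact hpB
  have hDpE : ∀ v, v ∈ D ∪ {p} → v ∉ E := by
    rintro v (hv | rfl)
    · exact hDE v hv
    · exact hpE
  by_cases hpP : ∃ i, p ∈ P i
  swap
  · push Not at hpP
    refine ih _ hcard (D ∪ {p}) E P rfl hDpB hEB hDp hE hP hsP hPA hDpE ?_ hEP hPP
      (fun i => (tD i).mono Set.subset_union_left subset_rfl) tE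
    rintro i v (hv | rfl)
    · exact hDP i v hv
    · exact hpP i
  obtain ⟨i, hpi⟩ := hpP
  have hsp : s i ≠ p := fun heq => h.sB i (heq ▸ hpB)
  -- the part of `P i` reachable from `s i` without `p`
  let R : Set V := {q | RIn G (P i \ {p}) (s i) q}
  have hsR : s i ∈ R := Relation.ReflTransGen.refl
  have hRP : R ⊆ P i \ {p} := by
    intro q hq
    exact RIn.closed (Z := P i \ {p}) (fun _ _ q hq _ _ => hq) ⟨hsP i, hsp⟩ hq
  have hRstep : ∀ q ∈ R, ∀ r ∈ P i, r ≠ p → G.Adj q r → r ∈ R := by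
    intro q hq r hr hrp hqr
    exact Relation.ReflTransGen.tail hq ⟨hRP hq, ⟨hr, hrp⟩, hqr⟩
  have hR : Conn G R := by
    refine Conn.of_base (s i) hsR ?_
    intro q hq
    have hq' : RIn G (P i \ {p}) (s i) q := hq
    clear hq
    induction hq' with
    | refl => exact Relation.ReflTransGen.refl
    | tail h1 h2 ih' =>
      exact Relation.ReflTransGen.tail ih' ⟨h1, Relation.ReflTransGen.tail h1 h2, h2.2.2⟩
  have hpR : p ∉ R := fun hp => (hRP hp).2 rfl
  have hQ : Conn G (P i \ R) := by
    refine Conn.of_base p ⟨hpi, hpR⟩ ?_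
    intro q hq
    have h1 := (hP i).2 p hpi q hq.1
    have h2 : q ∈ R ∨ RIn G (P i \ R) p q := by
      refine RIn.closed (Z := {q | q ∈ R ∨ RIn G (P i \ R) p q}) ?_
        (Or.inr Relation.ReflTransGen.refl) h1
      intro a ha b hb hab ha'
      by_cases hbp : b = p
      · subst hbp; exact Or.inr Relation.ReflTransGen.refl
      by_cases hbR : b ∈ R
      · exact Or.inl hbR
      right
      rcases ha' with ha' | ha'
      · exact absurd (hRstep a ha' b hb hbp hab) hbR
      · have haR : a ∉ R := fun haR => hbR (hRstep a haR b hb hbp hab)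
        exact Relation.ReflTransGen.tail ha' ⟨⟨ha, haR⟩, ⟨hb, hbR⟩, hab⟩
    exact h2.resolve_left hq.2
  have tpR : ∃ r ∈ R, G.Adj p r := by
    by_contra hno
    push Not at hno
    have : P i ⊆ R := (hP i).closed (fun a _ b hb hab haR => by
      refine hRstep a haR b hb ?_ hab
      rintro rfl
      exact hno a haR hab.symm) (hsP i) hsR
    exact hpR (this hpi)
  obtain ⟨r, hrR, hpr⟩ := tpR
  by_cases tER : Touch G E R
  · -- enlarge `D`
    have hsub : ∀ j, Function.update P i R j ⊆ P j := by
      intro j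
      by_cases hj : j = i
      · subst hj; simp only [Function.update_self]; exact fun v hv => (hRP hv).1
      · simp only [Function.update_of_ne hj]; exact subset_rfl
    refine ih _ hcard (D ∪ {p}) E (Function.update P i R) rfl hDpB hEB hDp hE ?_ ?_ ?_ hDpE ?_ ?_
      ?_ ?_ ?_
    · intro j
      by_cases hj : j = i
      · subst hj; simpa using hR
      · simpa [Function.update_of_ne hj] using hP j
    · intro j
      by_cases hj : j = i
      · subst hj; simpa using hsR
      · simpa [Function.update_of_ne hj] using hsP j
    · exact fun j v hv => hPA j v (hsub j hv)
    · rintro j v (hv | rfl)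
      · exact fun hv' => hDP j v hv (hsub j hv')
      · intro hv'
        by_cases hj : j = i
        · subst hj; simp only [Function.update_self] at hv'; exact hpR hv'
        · exact hPP i j (fun h => hj h.symm) v hpi (hsub j hv')
    · exact fun j v hv hv' => hEP j v hv (hsub j hv')
    · exact fun j l hjl v hv hv' => hPP j l hjl v (hsub j hv) (hsub l hv')
    · intro j
      by_cases hj : j = i
      · subst hj; simp only [Function.update_self]; exact ⟨p, Or.inr rfl, r, hrR, hpr⟩
      · simp only [Function.update_of_ne hj]
        exact (tD j).mono Set.subset_union_left subset_rfl
    · intro j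
      by_cases hj : j = i
      · subst hj; simpa using tER
      · simpa [Function.update_of_ne hj] using tE j
  · -- the graph `P₇`
    have tEQ : Touch G (P i \ R) E := by
      obtain ⟨a, ha, b, hb, hab⟩ := tE i
      exact ⟨b, ⟨hb, fun hbR => tER ⟨a, ha, b, hbR, hab⟩⟩, a, ha, hab.symm⟩
    have hRi : ∀ v, v ∈ R → v ∈ P i := fun v hv => (hRP hv).1
    let σ : Equiv.Perm (Fin 4) := Equiv.swap 0 i
    have hσ0 : σ 0 = i := Equiv.swap_apply_left 0 i
    have hσ : ∀ j, j ≠ 0 → i ≠ σ j := by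
      intro j hj heq
      rw [← hσ0] at heq
      exact hj (σ.injective heq).symm
    have hσσ : ∀ j l, j ≠ l → σ j ≠ σ l := fun j l hjl => σ.injective.ne hjl
    have hRP' : ∀ j, j ≠ 0 → ∀ v, v ∈ R → v ∉ P (σ j) := fun j hj v hv =>
      hPP i (σ j) (hσ j hj) v (hRi v hv)
    have tRP : ∀ j, j ≠ 0 → Touch G R (P (σ j)) := fun j hj =>
      ⟨_, hsR, _, hsP _, h.cl _ _ (hσ j hj)⟩
    refine ⟨_, _, _, IsPetersenFamily.deltaY IsPetersenFamily.k6 (a := 0) (b := 1) (c := 2)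
      (by simp) (by simp) (by simp),
      model_P7 (f := ![D, E, R, P (σ 1), P (σ 2), P (σ 3)]) (X := P i \ R) ?_ hQ ?_ ?_ ?_
        ⟨p, ⟨hpi, hpR⟩, d, hd, hdp.symm⟩ tEQ ⟨p, ⟨hpi, hpR⟩, r, hrR, hpr⟩, ?_⟩
    · intro i
      fin_cases i
      exacts [hD, hE, hR, hP _, hP _, hP _]
    · intro a b hab
      fin_cases a <;> fin_cases b <;>
          first
          | (exfalso; revert hab; decide)
          | exact hDE
          | exact hDP _
          | exact hEP _
          | exact fun v hv hv' => hDP i v hv (hRi v hv')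
          | exact fun v hv hv' => hEP i v hv (hRi v hv')
          | exact hRP' _ (by decide)
          | exact hPP _ _ (hσσ _ _ (by decide))
    · intro a
      fin_cases a
      · exact fun v hv hv' => hDP i v hv' hv.1
      · exact fun v hv hv' => hEP i v hv' hv.1
      · exact fun v hv hv' => hv.2 hv'
      · exact fun v hv => hPP i _ (hσ 1 (by decide)) v hv.1
      · exact fun v hv => hPP i _ (hσ 2 (by decide)) v hv.1
      · exact fun v hv => hPP i _ (hσ 3 (by decide)) v hv.1
    · intro a b hab hb
      fin_cases a <;> fin_cases b <;>
          first
          | (exfalso; revert hab; decide)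
          | (exfalso; revert hb; decide)
          | exact tD _
          | exact tE _
          | exact tRP _ (by decide)
          | exact tPP _ _ (hσσ _ _ (by decide))
    · rintro (_ | a)
      · exact fun v hv => hPA i v hv.1
      · fin_cases a
        exacts [hDA, hEA, fun v hv => hPA i v (hRi v hv), hPA _, hPA _, hPA _]

theorem CS.twoFull {V W : Type} [Finite V] {G : SimpleGraph V} {s : Fin 4 → V} {A B : Set V}
    (h : CS G s A B) {H : SimpleGraph W} {f : W → Set V} (hf : Model H G f) (e : Fin 4 → W)
    (he : ∀ i, s i ∈ f (e i)) (hinj : Function.Injective e) (D E : Set V) (hD : Conn G D)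
    (hE : Conn G E) (hDB : D ⊆ B) (hEB : E ⊆ B) (hDE : ∀ v, v ∈ D → v ∉ E)
    (hDP : ∀ i v, v ∈ D → v ∉ f (e i)) (hEP : ∀ i v, v ∈ E → v ∉ f (e i))
    (tD : ∀ i, Touch G D (f (e i))) (tE : ∀ i, Touch G E (f (e i))) : GoodSide G A := by
  have hdiff : ∀ X : Set V, X ⊆ B → X \ A = X := by
    intro X hX
    ext v
    exact ⟨fun hv => hv.1, fun hv => ⟨hv, fun hvA => h.AB v hvA (hX hv)⟩⟩
  refine h.endgame _ D E (fun i => f (e i) \ A) rfl hDB hEB hD hE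
    (fun i => h.retract (hf.conn _) i (he i)) (fun i => ⟨he i, h.sA i⟩) (fun i v hv => hv.2) hDE
    (fun i v hv hv' => hDP i v hv hv'.1) (fun i v hv hv' => hEP i v hv hv'.1) ?_ ?_ ?_
  · intro i j hij v hv hv'
    exact hij (hinj (hf.disj _ _ v hv.1 hv'.1))
  · intro i
    have := h.touch_diff (Or.inr hDB) (Or.inl ⟨i, he i⟩) (hDP i) (tD i)
    rwa [hdiff D hDB] at this
  · intro i
    have := h.touch_diff (Or.inr hEB) (Or.inl ⟨i, he i⟩) (hEP i) (tE i)
    rwa [hdiff E hEB] at this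

theorem CS.main {V : Type} [Finite V] {G : SimpleGraph V} {s : Fin 4 → V} {A B : Set V}
    (h : CS G s A B) : ∀ n c, (n, c) ∈ petData → IsPetersenFamily (LG n c) →
    ∀ f, Model (LG n c) G f → GoodSide G A ∨ GoodSide G B := by
  classical
  intro n
  induction n using Nat.strong_induction_on with
  | _ n ih =>
  intro c hd hpet f hf
  by_cases hA : ∃ w, f w ⊆ A
  swap
  · push Not at hA
    exact Or.inl ⟨_, _, _, hpet, h.model_diff hf hA, fun w v hv => hv.2⟩
  by_cases hB : ∃ w, f w ⊆ B
  swap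
  · push Not at hB
    exact Or.inr ⟨_, _, _, hpet, h.symm.model_diff hf hB, fun w v hv => hv.2⟩
  obtain ⟨a, ha⟩ := hA
  obtain ⟨b, hb⟩ := hB
  let T : Fin n → Bool := fun w => decide (∃ i, s i ∈ f w)
  let m := Nat.ofBits T
  have hm : m < 2 ^ n := Nat.ofBits_lt_two_pow T
  have hmT : ∀ w : Fin n, m.testBit w = T w := fun w => Nat.testBit_ofBits_lt T w w.2
  have hTt : ∀ w : Fin n, m.testBit w = true ↔ ∃ i, s i ∈ f w := by
    intro w; rw [hmT]; simp [T]
  have hTf : ∀ w : Fin n, m.testBit w = false ↔ ¬ ∃ i, s i ∈ f w := by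
    intro w; rw [hmT]; simp [T]
  have hg : ∃ g : Fin n → Fin 4, ∀ w, (∃ i, s i ∈ f w) → s (g w) ∈ f w := by
    refine ⟨fun w => if hw : ∃ i, s i ∈ f w then hw.choose else 0, ?_⟩
    intro w hw
    simp only [hw, dif_pos]
    exact hw.choose_spec
  obtain ⟨g, hg⟩ := hg
  have hginj : Set.InjOn g (Finset.univ.filter fun i : Fin n => m.testBit i = true) := by
    intro u hu w hw huw
    simp only [Finset.coe_filter, Finset.mem_univ, true_and, Set.mem_ofPred_eq] at hu hw
    have h1 := hg u ((hTt u).1 hu)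
    have h2 := hg w ((hTt w).1 hw)
    rw [huw] at h1
    exact hf.disj _ _ _ h1 h2
  have hside : ∀ w : Fin n, m.testBit w = false → f w ⊆ A ∨ f w ⊆ B := by
    intro w hw
    exact (h.trich (hf.conn w)).resolve_left ((hTf w).1 hw)
  rcases cut_check (n, c) hd m hm with hc | (hc | hc) | hc
  · exfalso
    have := Finset.card_le_card_of_injOn g (t := Finset.univ) (fun _ _ => Finset.mem_univ _) hginj
    simp only [Finset.card_univ, Fintype.card_fin] at this
    dsimp only at hc
    omega
  · obtain ⟨v, hv, hdeg, hN⟩ := hc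
    obtain ⟨n', c', hn, hd', a', b', d', h1, h2, h3, φ, hφ⟩ := petY n c hd v hdeg
    have hNT : ∀ p, (p = a' ∨ p = b' ∨ p = d') → ∃ i, s i ∈ f (φ (some p)) := by
      intro p hp
      rw [← hTt]
      apply hN
      rw [← hφ, φ.map_adj_iff, triangleY_none]
      exact hp
    have hmod := hf.comp_inj (H' := LG n' c') (fun u => φ (some u))
      (fun u w huw => Option.some_injective _ (φ.injective huw)) (by
        intro p q hpq
        by_cases hT : (p = a' ∨ p = b' ∨ p = d') ∧ (q = a' ∨ q = b' ∨ q = d')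
        · right
          refine h.touch (hNT p hT.1) (hNT q hT.2) ?_
          intro v hv1 hv2
          have h4 := hf.disj _ _ v hv1 hv2
          exact hpq.ne (Option.some_injective _ (φ.injective h4))
        · left
          rw [φ.map_adj_iff, triangleY_some]
          exact ⟨hpq, hT⟩)
    exact ih n' (by omega) c' hd' ((hpet.iso φ.symm).yDelta h1 h2 h3) _ hmod
  · exfalso
    have haF : m.testBit a = false := by
      rw [hTf]; rintro ⟨i, hi⟩; exact h.sA i (ha hi)
    have hbF : m.testBit b = false := by
      rw [hTf]; rintro ⟨i, hi⟩; exact h.sB i (hb hi)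
    have hstep : ∀ u w : Fin n, m.testBit u = false → m.testBit w = false → (LG n c).Adj u w →
        f u ⊆ A → f w ⊆ A := by
      intro u w hu hw huw huA
      rcases hside w hw with h1 | h1
      · exact h1
      · obtain ⟨p, hp, q, hq, hpq⟩ := hf.adj u w huw
        exact absurd hpq (h.noE p (huA hp) q (h1 hq))
    have hbA := cutConn_sound hm hc (fun w => f w ⊆ A) (fun u w hu hw huw =>
      ⟨hstep u w hu hw huw, hstep w u hw hu huw.symm⟩) a b haF hbF ha
    obtain ⟨v, hv⟩ := (hf.conn b).1
    exact h.AB v (hbA hv) (hb hv)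
  · obtain ⟨hcard, u₁, w₁, F₁, u₂, w₂, F₂, d₁₂, u₃, w₃, F₃, d₁₃, d₂₃⟩ := hc
    dsimp only at *
    have himg : (Finset.univ.filter fun i : Fin n => m.testBit i = true).image g = Finset.univ := by
      apply Finset.eq_univ_of_card
      rw [Finset.card_image_of_injOn hginj, hcard]
      simp
    have hex : ∀ i : Fin 4, ∃ w : Fin n, m.testBit w = true ∧ s i ∈ f w := by
      intro i
      have hi : i ∈ (Finset.univ.filter fun i : Fin n => m.testBit i = true).image g := by
        rw [himg]; exact Finset.mem_univ i
      rw [Finset.mem_image] at hi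
      obtain ⟨w, hw, rfl⟩ := hi
      have hw := (Finset.mem_filter.1 hw).2
      exact ⟨w, hw, hg w ((hTt w).1 hw)⟩
    choose e heT he using hex
    have heinj : Function.Injective e := by
      intro i j hij
      by_contra hne
      -- the map `e` is a section of the injective map `g`, by counting
      have hsub : Finset.univ.image e = Finset.univ.filter fun i : Fin n => m.testBit i = true := by
        ext w
        simp only [Finset.mem_image, Finset.mem_univ, true_and, Finset.mem_filter]
        constructor
        · rintro ⟨k, rfl⟩; exact heT k
        · intro hw
          refine ⟨g w, hf.disj _ _ (s (g w)) (he _) (hg w ((hTt w).1 hw))⟩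
      have hc2 : (Finset.univ.image e).card = (Finset.univ : Finset (Fin 4)).card := by
        rw [hsub, hcard]; simp
      have := Finset.card_image_iff.1 hc2
      exact hne (this (by simp) (by simp) hij)
    have hcon : ∀ u w, FullPair n c m u w → Conn G (f u ∪ f w) := by
      rintro u w ⟨-, -, h1 | h1, -⟩
      · subst h1; rw [Set.union_self]; exact hf.conn u
      · exact (hf.conn u).union (hf.conn w) (hf.adj u w h1)
    have hsd : ∀ u w, FullPair n c m u w → f u ∪ f w ⊆ A ∨ f u ∪ f w ⊆ B := by
      rintro u w hF
      refine (h.trich (hcon u w hF)).resolve_left ?_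
      rintro ⟨i, hi | hi⟩
      · exact (hTf u).1 hF.1 ⟨i, hi⟩
      · exact (hTf w).1 hF.2.1 ⟨i, hi⟩
    have hdP : ∀ u w, FullPair n c m u w → ∀ i v, v ∈ f u ∪ f w → v ∉ f (e i) := by
      rintro u w hF i v (hv | hv) hv'
      · have h1 := hf.disj _ _ v hv hv'
        have h2 := hF.1
        rw [h1, heT i] at h2
        exact Bool.noConfusion h2
      · have h1 := hf.disj _ _ v hv hv'
        have h2 := hF.2.1
        rw [h1, heT i] at h2
        exact Bool.noConfusion h2
    have htP : ∀ u w, FullPair n c m u w → ∀ i, Touch G (f u ∪ f w) (f (e i)) := by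
      rintro u w hF i
      rcases hF.2.2.2 (e i) (heT i) with h1 | h1
      · exact (hf.adj _ _ h1).symm.mono Set.subset_union_left subset_rfl
      · exact (hf.adj _ _ h1).symm.mono Set.subset_union_right subset_rfl
    have hdd : ∀ u w u' w', (u ≠ u' ∧ u ≠ w' ∧ w ≠ u' ∧ w ≠ w') →
        ∀ v, v ∈ f u ∪ f w → v ∉ f u' ∪ f w' := by
      rintro u w u' w' ⟨h1, h2, h3, h4⟩ v (hv | hv) (hv' | hv')
      · exact h1 (hf.disj _ _ v hv hv')
      · exact h2 (hf.disj _ _ v hv hv')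
      · exact h3 (hf.disj _ _ v hv hv')
      · exact h4 (hf.disj _ _ v hv hv')
    have hgoA : ∀ u w u' w', FullPair n c m u w → FullPair n c m u' w' →
        (u ≠ u' ∧ u ≠ w' ∧ w ≠ u' ∧ w ≠ w') → f u ∪ f w ⊆ A → f u' ∪ f w' ⊆ A →
        GoodSide G A ∨ GoodSide G B := by
      intro u w u' w' hF hF' hne h1 h2
      exact Or.inr (h.symm.twoFull hf e he heinj _ _ (hcon _ _ hF) (hcon _ _ hF') h1 h2
        (hdd _ _ _ _ hne) (hdP _ _ hF) (hdP _ _ hF') (htP _ _ hF) (htP _ _ hF'))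
    have hgoB : ∀ u w u' w', FullPair n c m u w → FullPair n c m u' w' →
        (u ≠ u' ∧ u ≠ w' ∧ w ≠ u' ∧ w ≠ w') → f u ∪ f w ⊆ B → f u' ∪ f w' ⊆ B →
        GoodSide G A ∨ GoodSide G B := by
      intro u w u' w' hF hF' hne h1 h2
      exact Or.inl (h.twoFull hf e he heinj _ _ (hcon _ _ hF) (hcon _ _ hF') h1 h2
        (hdd _ _ _ _ hne) (hdP _ _ hF) (hdP _ _ hF') (htP _ _ hF) (htP _ _ hF'))
    rcases hsd _ _ F₁ with s1 | s1 <;> rcases hsd _ _ F₂ with s2 | s2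
    · exact hgoA _ _ _ _ F₁ F₂ d₁₂ s1 s2
    · rcases hsd _ _ F₃ with s3 | s3
      · exact hgoA _ _ _ _ F₁ F₃ d₁₃ s1 s3
      · exact hgoB _ _ _ _ F₂ F₃ d₂₃ s2 s3
    · rcases hsd _ _ F₃ with s3 | s3
      · exact hgoA _ _ _ _ F₂ F₃ d₂₃ s2 s3
      · exact hgoB _ _ _ _ F₁ F₃ d₁₃ s1 s3
    · exact hgoB _ _ _ _ F₁ F₂ d₁₂ s1 s2

/-! ### From models in the completed graph back to `G` -/

theorem model_direct {V W : Type} {G G' : SimpleGraph V} {H : SimpleGraph W} {f : W → Set V}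
    (hf : Model H G' f)
    (h1 : ∀ w p q, p ∈ f w → q ∈ f w → G'.Adj p q → G.Adj p q)
    (h2 : ∀ w₁ w₂ p q, p ∈ f w₁ → q ∈ f w₂ → H.Adj w₁ w₂ → G'.Adj p q → G.Adj p q) :
    Model H G f := by
  refine ⟨fun w => (hf.conn w).mono_graph fun p hp q hq => h1 w p q hp hq, hf.disj, ?_⟩
  intro w₁ w₂ hw
  obtain ⟨p, hp, q, hq, hpq⟩ := hf.adj w₁ w₂ hw
  exact ⟨p, hp, q, hq, h2 w₁ w₂ p q hp hq hw hpq⟩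

theorem absorb {V W : Type} {G G' : SimpleGraph V} {H : SimpleGraph W} {f : W → Set V}
    {A N : Set V} (hf : Model H G' f) (hA : Conn G A) (hfA : ∀ w v, v ∈ f w → v ∉ A)
    (hN : ∀ p ∈ N, ∃ a ∈ A, G.Adj p a)
    (hE : ∀ p q, G'.Adj p q → ¬ G.Adj p q → p ∈ N ∧ q ∈ N)
    (w₀ : W) (n₀ : V) (hn₀ : n₀ ∈ N) (hnf : n₀ ∈ f w₀)
    (h1 : ∀ w p q, p ∈ f w → q ∈ f w → G'.Adj p q → ¬ G.Adj p q → w = w₀)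
    (h2 : ∀ w₁ w₂ p q, p ∈ f w₁ → q ∈ f w₂ → H.Adj w₁ w₂ → G'.Adj p q → ¬ G.Adj p q →
      w₁ = w₀ ∨ w₂ = w₀) : IsMinor H G := by
  rw [isMinor_iff]
  refine ⟨fun w => {v | v ∈ f w ∨ (w = w₀ ∧ v ∈ A)}, ?_, ?_, ?_⟩
  · intro w
    by_cases hw : w = w₀
    · subst hw
      have hX : {v | v ∈ f w ∨ (w = w ∧ v ∈ A)} = f w ∪ A := by ext v; simp
      rw [hX]
      have hstep : ∀ p ∈ f w, ∀ a ∈ A, p ∈ N → RIn G (f w ∪ A) p a := by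
        intro p hp a ha hpN
        obtain ⟨a', ha', hpa⟩ := hN p hpN
        have h3 : RIn G (f w ∪ A) p a' := RIn.single (Or.inl hp) (Or.inr ha') hpa
        exact h3.trans ((hA.2 a' ha' a ha).mono Set.subset_union_right)
      refine Conn.of_base n₀ (Or.inl hnf) ?_
      rintro v (hv | hv)
      · refine RIn.map (Y := f w ∪ A) id ?_ ((hf.conn w).2 n₀ hnf v hv)
        intro p hp q hq hpq
        by_cases hg : G.Adj p q
        · exact RIn.single (Or.inl hp) (Or.inl hq) hg
        · obtain ⟨a, ha⟩ := hA.1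
          obtain ⟨hp', hq'⟩ := hE p q hpq hg
          exact (hstep p hp a ha hp').trans (hstep q hq a ha hq').symm
      · exact hstep n₀ hnf v hv hn₀
    · have hX : {v | v ∈ f w ∨ (w = w₀ ∧ v ∈ A)} = f w := by ext v; simp [hw]
      rw [hX]
      refine (hf.conn w).mono_graph fun p hp q hq hpq => ?_
      by_contra hg
      exact hw (h1 w p q hp hq hpq hg)
  · rintro w₁ w₂ v (hv | ⟨rfl, hv⟩) (hv' | ⟨rfl, hv'⟩)
    · exact hf.disj _ _ v hv hv'
    · exact absurd hv' (hfA _ _ hv)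
    · exact absurd hv (hfA _ _ hv')
    · rfl
  · intro w₁ w₂ hw
    obtain ⟨p, hp, q, hq, hpq⟩ := hf.adj w₁ w₂ hw
    by_cases hg : G.Adj p q
    · exact ⟨p, Or.inl hp, q, Or.inl hq, hg⟩
    · obtain ⟨hp', hq'⟩ := hE p q hpq hg
      rcases h2 w₁ w₂ p q hp hq hw hpq hg with h | h
      · obtain ⟨a, ha, hqa⟩ := hN q hq'
        exact ⟨a, Or.inr ⟨h, ha⟩, q, Or.inl hq, hqa.symm⟩
      · obtain ⟨a, ha, hpa⟩ := hN p hp'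
        exact ⟨p, Or.inl hp, a, Or.inr ⟨h, ha⟩, hpa⟩

theorem tri_lift {V : Type} {G G' : SimpleGraph V} {A N : Set V} {t : V} (hl : IsLinkless G)
    (hA : Conn G A) (hN : ∀ p ∈ N, ∃ a ∈ A, G.Adj p a) (ht : t ∈ N)
    (hE : ∀ p q, G'.Adj p q → ¬ G.Adj p q → p ∈ N ∧ q ∈ N)
    (hb : ∀ p q, G'.Adj p q → ¬ G.Adj p q → p = t ∨ q = t) : ¬ GoodSide G' A := by
  rintro ⟨W, H, f, hH, hf, hfA⟩
  by_cases h : ∃ w, t ∈ f w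
  · obtain ⟨w₀, h₀⟩ := h
    refine hl H hH (absorb hf hA hfA hN hE w₀ t ht h₀ ?_ ?_)
    · intro w p q hp hq hpq hg
      rcases hb p q hpq hg with rfl | rfl
      · exact hf.disj _ _ _ hp h₀
      · exact hf.disj _ _ _ hq h₀
    · intro w₁ w₂ p q hp hq _ hpq hg
      rcases hb p q hpq hg with rfl | rfl
      · exact Or.inl (hf.disj _ _ _ hp h₀)
      · exact Or.inr (hf.disj _ _ _ hq h₀)
  · push Not at h
    refine hl H hH (isMinor_iff.2 ⟨f, model_direct hf ?_ ?_⟩)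
    · intro w p q hp hq hpq
      by_contra hg
      rcases hb p q hpq hg with rfl | rfl
      · exact h _ hp
      · exact h _ hq
    · intro w₁ w₂ p q hp hq _ hpq
      by_contra hg
      rcases hb p q hpq hg with rfl | rfl
      · exact h _ hp
      · exact h _ hq

/-- two of the three vertices `a b c` in the same, or in adjacent, branch sets -/
theorem claw_core {V W : Type} {G G' : SimpleGraph V} {H : SimpleGraph W} {f : W → Set V}
    {A N : Set V} {a b c : V} (hl : IsLinkless G) (hH : IsPetersenFamily H)
    (hf : Model H G' f) (hA : Conn G A) (hfA : ∀ w v, v ∈ f w → v ∉ A)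
    (hN : ∀ p ∈ N, ∃ a ∈ A, G.Adj p a) (ha : a ∈ N) (hb : b ∈ N) (hc : c ∈ N)
    (hE : ∀ p q, G'.Adj p q → ¬ G.Adj p q →
      p ≠ q ∧ (p = a ∨ p = b ∨ p = c) ∧ (q = a ∨ q = b ∨ q = c))
    {w₁ w₂ : W} (h1 : a ∈ f w₁) (h2 : b ∈ f w₂) (hw : w₁ = w₂ ∨ H.Adj w₁ w₂) : False := by
  have hE' : ∀ p q, G'.Adj p q → ¬ G.Adj p q → p ∈ N ∧ q ∈ N := by
    intro p q hpq hg
    obtain ⟨-, h3, h4⟩ := hE p q hpq hg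
    constructor
    · rcases h3 with rfl | rfl | rfl <;> assumption
    · rcases h4 with rfl | rfl | rfl <;> assumption
  have D := hf.disj
  have key : ∀ (w₀ : W) (n₀ : V), n₀ ∈ N → n₀ ∈ f w₀ →
      (∀ u₁ u₂ p q, p ∈ f u₁ → q ∈ f u₂ → p ≠ q → (p = a ∨ p = b ∨ p = c) →
        (q = a ∨ q = b ∨ q = c) → (u₁ = u₂ ∨ H.Adj u₁ u₂) → u₁ = w₀ ∨ u₂ = w₀) → False := by
    intro w₀ n₀ hn hnf hk
    refine hl H hH (absorb hf hA hfA hN hE' w₀ n₀ hn hnf ?_ ?_)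
    · intro w p q hp hq hpq hg
      obtain ⟨h5, h3, h4⟩ := hE p q hpq hg
      exact (hk w w p q hp hq h5 h3 h4 (Or.inl rfl)).elim id id
    · intro u₁ u₂ p q hp hq hu hpq hg
      obtain ⟨h5, h3, h4⟩ := hE p q hpq hg
      exact hk u₁ u₂ p q hp hq h5 h3 h4 (Or.inr hu)
  have hfa : ∀ u, a ∈ f u → u = w₁ := fun u hu => D _ _ _ hu h1
  have hfb : ∀ u, b ∈ f u → u = w₂ := fun u hu => D _ _ _ hu h2
  by_cases h12 : w₁ = w₂
  · subst h12
    refine key w₁ a ha h1 ?_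
    rintro u₁ u₂ p q hp hq hne (rfl | rfl | rfl) (rfl | rfl | rfl) - <;> grind
  have hw := hw.resolve_left h12
  by_cases h3 : ∃ w, c ∈ f w
  swap
  · push Not at h3
    refine key w₁ a ha h1 ?_
    rintro u₁ u₂ p q hp hq hne (rfl | rfl | rfl) (rfl | rfl | rfl) - <;> grind
  obtain ⟨w₃, h3⟩ := h3
  have hfc : ∀ u, c ∈ f u → u = w₃ := fun u hu => D _ _ _ hu h3
  by_cases h13 : H.Adj w₁ w₃
  swap
  · have h31 : ¬ H.Adj w₃ w₁ := fun h => h13 h.symm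
    by_cases h13' : w₁ = w₃
    · refine key w₁ a ha h1 ?_
      rintro u₁ u₂ p q hp hq hne (rfl | rfl | rfl) (rfl | rfl | rfl) hu <;> grind
    · refine key w₂ b hb h2 ?_
      rintro u₁ u₂ p q hp hq hne (rfl | rfl | rfl) (rfl | rfl | rfl) hu <;> grind
  by_cases h23 : H.Adj w₂ w₃
  swap
  · have h32 : ¬ H.Adj w₃ w₂ := fun h => h23 h.symm
    by_cases h23' : w₂ = w₃
    · refine key w₂ b hb h2 ?_
      rintro u₁ u₂ p q hp hq hne (rfl | rfl | rfl) (rfl | rfl | rfl) hu <;> grind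
    · refine key w₁ a ha h1 ?_
      rintro u₁ u₂ p q hp hq hne (rfl | rfl | rfl) (rfl | rfl | rfl) hu <;> grind
  have n13 := h13.ne
  have n23 := h23.ne
  have hT : ∀ u p, p ∈ f u → (p = a ∨ p = b ∨ p = c) → (u = w₁ ∨ u = w₂ ∨ u = w₃) := by
    rintro u p hp (rfl | rfl | rfl)
    · exact Or.inl (hfa _ hp)
    · exact Or.inr (Or.inl (hfb _ hp))
    · exact Or.inr (Or.inr (hfc _ hp))
  have hAt : ∀ u, (u = w₁ ∨ u = w₂ ∨ u = w₃) → Touch G (f u) A := by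
    rintro u (rfl | rfl | rfl)
    · obtain ⟨v, hv, h⟩ := hN a ha; exact ⟨a, h1, v, hv, h⟩
    · obtain ⟨v, hv, h⟩ := hN b hb; exact ⟨b, h2, v, hv, h⟩
    · obtain ⟨v, hv, h⟩ := hN c hc; exact ⟨c, h3, v, hv, h⟩
  refine hl _ (hH.deltaY hw h23 h13) (isMinor_iff.2 ⟨fun o => o.elim A f, ?_, ?_, ?_⟩)
  · rintro (_ | u)
    · exact hA
    · refine (hf.conn u).mono_graph fun p hp q hq hpq => ?_
      by_contra hg
      obtain ⟨h5, h6, h7⟩ := hE p q hpq hg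
      rcases h6 with rfl | rfl | rfl <;> rcases h7 with rfl | rfl | rfl <;> grind
  · rintro (_ | u) (_ | u') v hv hv'
    · rfl
    · exact absurd hv (hfA _ _ hv')
    · exact absurd hv' (hfA _ _ hv)
    · exact congrArg some (D _ _ v hv hv')
  · rintro (_ | u) (_ | u') hu
    · exact absurd rfl hu.ne
    · rw [triangleY_none] at hu
      exact (hAt _ hu).symm
    · rw [triangleY_none'] at hu
      exact hAt _ hu
    · rw [triangleY_some] at hu
      obtain ⟨p, hp, q, hq, hpq⟩ := hf.adj u u' hu.1
      refine ⟨p, hp, q, hq, ?_⟩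
      by_contra hg
      obtain ⟨h5, h6, h7⟩ := hE p q hpq hg
      exact hu.2 ⟨hT _ _ hp h6, hT _ _ hq h7⟩

theorem claw_lift {V : Type} {G G' : SimpleGraph V} {A N : Set V} {a b c : V} (hl : IsLinkless G)
    (hA : Conn G A) (hN : ∀ p ∈ N, ∃ a ∈ A, G.Adj p a) (ha : a ∈ N) (hb : b ∈ N) (hc : c ∈ N)
    (hE : ∀ p q, G'.Adj p q → ¬ G.Adj p q →
      p ≠ q ∧ (p = a ∨ p = b ∨ p = c) ∧ (q = a ∨ q = b ∨ q = c)) : ¬ GoodSide G' A := by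
  rintro ⟨W, H, f, hH, hf, hfA⟩
  have key : ∀ w₁ w₂ p q, p ∈ f w₁ → q ∈ f w₂ → (w₁ = w₂ ∨ H.Adj w₁ w₂) → G'.Adj p q →
      G.Adj p q := by
    intro w₁ w₂ p q hp hq hw hpq
    by_contra hg
    obtain ⟨h5, h6, h7⟩ := hE p q hpq hg
    have hperm : ∀ r, r ∈ N → (∀ v, (v = a ∨ v = b ∨ v = c) → (v = p ∨ v = q ∨ v = r)) →
        p ∈ N → q ∈ N → False := by
      intro r hr hv hpN hqN
      refine claw_core hl hH hf hA hfA hN hpN hqN hr ?_ hp hq hw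
      intro p' q' h8 h9
      obtain ⟨h10, h11, h12⟩ := hE p' q' h8 h9
      exact ⟨h10, hv _ h11, hv _ h12⟩
    rcases h6 with rfl | rfl | rfl <;> rcases h7 with rfl | rfl | rfl
    · exact h5 rfl
    · exact hperm c hc (by tauto) ha hb
    · exact hperm b hb (by tauto) ha hc
    · exact hperm c hc (by tauto) hb ha
    · exact h5 rfl
    · exact hperm a ha (by tauto) hb hc
    · exact hperm b hb (by tauto) hc ha
    · exact hperm a ha (by tauto) hc hb
    · exact h5 rfl
  exact hl H hH (isMinor_iff.2 ⟨f, model_direct hf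
    (fun w p q hp hq => key w w p q hp hq (Or.inl rfl))
    (fun w₁ w₂ p q hp hq hw => key w₁ w₂ p q hp hq (Or.inr hw))⟩)

/-! ### Components of the complement of a minimal cut -/

/-- the vertices reachable from `v` outside `S` -/
def Kset {V : Type} (G : SimpleGraph V) (S : Set V) (v : V) : Set V := {u | RIn G Sᶜ v u}

theorem Kset.self {V : Type} (G : SimpleGraph V) (S : Set V) (v : V) : v ∈ Kset G S v :=
  Relation.ReflTransGen.refl

theorem Kset.not_mem {V : Type} {G : SimpleGraph V} {S : Set V} {v u : V} (hv : v ∉ S)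
    (hu : u ∈ Kset G S v) : u ∉ S :=
  RIn.closed (Z := Sᶜ) (fun _ _ _ hq _ _ => hq) hv hu

theorem Kset.step {V : Type} {G : SimpleGraph V} {S : Set V} {v u q : V} (hv : v ∉ S)
    (hu : u ∈ Kset G S v) (hq : q ∉ S) (h : G.Adj u q) : q ∈ Kset G S v :=
  Relation.ReflTransGen.tail hu ⟨Kset.not_mem hv hu, hq, h⟩

theorem Kset.conn {V : Type} {G : SimpleGraph V} {S : Set V} {v : V} (hv : v ∉ S) :
    Conn G (Kset G S v) := by
  refine Conn.of_base v (Kset.self G S v) ?_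
  intro a ha
  have : a ∈ {u | u ∈ Kset G S v ∧ RIn G (Kset G S v) v u} := by
    refine RIn.closed (X := Sᶜ) ?_ ⟨Kset.self G S v, Relation.ReflTransGen.refl⟩ ha
    rintro p _ q hq hpq ⟨h1, h2⟩
    have h3 := Kset.step hv h1 hq hpq
    exact ⟨h3, h2.trans (RIn.single h1 h3 hpq)⟩
  exact this.2

theorem Kset.disj {V : Type} {G : SimpleGraph V} {S : Set V} {v w u : V}
    (h : w ∉ Kset G S v) (h1 : u ∈ Kset G S v) : u ∉ Kset G S w :=
  fun h2 => h (Relation.ReflTransGen.trans h1 (RIn.symm h2))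

theorem cut_two {V : Type} {G : SimpleGraph V} {S : Set V} (h : ¬ (G.induce Sᶜ).Preconnected) :
    ∃ v w, v ∉ S ∧ w ∉ S ∧ w ∉ Kset G S v := by
  by_contra hno
  push Not at hno
  apply h
  by_cases hne : (Sᶜ).Nonempty
  · exact (conn_iff.2 ⟨hne, fun a ha b hb => hno a b ha hb⟩).preconnected
  · intro a
    exact absurd ⟨a.1, a.2⟩ hne

theorem cut_full {V : Type} {G : SimpleGraph V} {S : Set V} (h : IsMinimalVertexCut G S) {v w : V}
    (hv : v ∉ S) (hw : w ∉ S) (hvw : w ∉ Kset G S v) {s : V} (hs : s ∈ S) :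
    ∃ a ∈ Kset G S v, G.Adj s a := by
  by_contra hno
  push Not at hno
  have hsub : S \ {s} ⊂ S := ⟨Set.sdiff_subset, fun hh => (hh hs).2 rfl⟩
  have h1 := h.2 _ hsub
  have h2 : (G.induce (S \ {s})ᶜ).Preconnected := by
    by_contra h2
    exact h1 ⟨h.1.1, h2⟩
  have hv' : v ∈ (S \ {s})ᶜ := fun hh => hv hh.1
  have hw' : w ∈ (S \ {s})ᶜ := fun hh => hw hh.1
  have h3 : Conn G (S \ {s})ᶜ := by
    rw [← conn_iff]
    have : Nonempty ↑((S \ {s})ᶜ) := ⟨⟨v, hv'⟩⟩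
    exact ⟨h2⟩
  refine hvw (h3.closed (Z := Kset G S v) ?_ hv' (Kset.self G S v) hw')
  intro p _ q hq hpq hp
  by_cases hqs : q = s
  · subst hqs
    exact absurd hpq.symm (hno p hp)
  · exact Kset.step hv hp (fun hqS => hq ⟨hqS, hqs⟩) hpq

/-- complete the set `S` -/
def fillIn {V : Type} (G : SimpleGraph V) (S : Set V) : SimpleGraph V where
  Adj p q := G.Adj p q ∨ (p ≠ q ∧ p ∈ S ∧ q ∈ S)
  symm := ⟨fun _ _ h => h.elim (fun h => Or.inl h.symm) fun h => Or.inr ⟨h.1.symm, h.2.2, h.2.1⟩⟩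
  loopless := ⟨fun _ h => h.elim (fun h => h.ne rfl) fun h => h.1 rfl⟩

theorem core {V : Type} [Finite V] {G : SimpleGraph V} (hG : IsMaxnil G) (s : Fin 4 → V)
    (hs : Function.Injective s) (hmin : IsMinimalVertexCut G (Set.range s))
    (h3 : ∀ A B C : Set V, Conn G A → Conn G B → Conn G C →
      (∀ i, s i ∉ A) → (∀ i, s i ∉ B) → (∀ i, s i ∉ C) →
      (∀ v, v ∈ A → v ∉ B) → (∀ v, v ∈ A → v ∉ C) → (∀ v, v ∈ B → v ∉ C) →
      (∀ i, ∃ a ∈ A, G.Adj (s i) a) → (∀ i, ∃ a ∈ B, G.Adj (s i) a) →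
      (∀ i, ∃ a ∈ C, G.Adj (s i) a) → False)
    (hl : ∀ A : Set V, Conn G A → (∀ p ∈ Set.range s, ∃ a ∈ A, G.Adj p a) →
      ¬ GoodSide (fillIn G (Set.range s)) A) : ∀ i j, i ≠ j → G.Adj (s i) (s j) := by
  intro i j hij
  by_contra hadj
  refine hG.2 (s i) (s j) (fun h => hij (hs h)) hadj ?_
  obtain ⟨v, w, hv, hw, hvw⟩ := cut_two hmin.1.2
  have hwv : v ∉ Kset G (Set.range s) w := fun h => hvw (RIn.symm h)
  have fullA := fun p (hp : p ∈ Set.range s) => cut_full hmin hv hw hvw hp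
  have fullB := fun p (hp : p ∈ Set.range s) => cut_full hmin hw hv hwv hp
  have cA := Kset.conn (G := G) hv
  have cB := Kset.conn (G := G) hw
  have sK : ∀ u, u ∉ Set.range s → ∀ k, s k ∉ Kset G (Set.range s) u :=
    fun u hu k hk => Kset.not_mem hu hk ⟨k, rfl⟩
  have hcov : ∀ u, (∃ i, u = s i) ∨ u ∈ Kset G (Set.range s) v ∨ u ∈ Kset G (Set.range s) w := by
    intro u
    by_contra hno
    push Not at hno
    obtain ⟨h4, h5, h6⟩ := hno
    have hu : u ∉ Set.range s := fun ⟨k, hk⟩ => h4 k hk.symm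
    exact h3 _ _ _ cA cB (Kset.conn hu) (sK v hv) (sK w hw) (sK u hu)
      (fun _ => Kset.disj hvw) (fun _ => Kset.disj h5) (fun _ => Kset.disj h6)
      (fun k => fullA _ ⟨k, rfl⟩) (fun k => fullB _ ⟨k, rfl⟩)
      (fun k => cut_full hmin hu hv (fun h => h5 (RIn.symm h)) ⟨k, rfl⟩)
  have hle : ∀ p q, G.Adj p q → (fillIn G (Set.range s)).Adj p q := fun _ _ h => Or.inl h
  have hcs : CS (fillIn G (Set.range s)) s (Kset G (Set.range s) v) (Kset G (Set.range s) w) := by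
    refine ⟨hs, fun k l hkl => Or.inr ⟨fun h => hkl (hs h), ⟨k, rfl⟩, ⟨l, rfl⟩⟩, hcov, sK v hv,
      sK w hw, fun _ => Kset.disj hvw, ?_, cA.mono_graph fun p _ q _ => hle p q,
      cB.mono_graph fun p _ q _ => hle p q⟩
    rintro a ha b hb (hab | ⟨-, h4, -⟩)
    · exact Kset.disj hvw (Kset.step hv ha (Kset.not_mem hw hb) hab) hb
    · exact Kset.not_mem hv ha h4
  intro W P hP hminor
  obtain ⟨f, hf⟩ := isMinor_iff.1 hminor
  have hle' : ∀ p q, (addEdge G (s i) (s j)).Adj p q → (fillIn G (Set.range s)).Adj p q := by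
    intro p q hpq
    rw [addEdge, SimpleGraph.sup_adj, SimpleGraph.fromEdgeSet_adj, Set.mem_singleton_iff,
      Sym2.eq_iff] at hpq
    rcases hpq with h | ⟨⟨rfl, rfl⟩ | ⟨rfl, rfl⟩, hne⟩
    · exact Or.inl h
    · exact Or.inr ⟨hne, ⟨_, rfl⟩, ⟨_, rfl⟩⟩
    · exact Or.inr ⟨hne, ⟨_, rfl⟩, ⟨_, rfl⟩⟩
  have hf' : Model P (fillIn G (Set.range s)) f :=
    model_direct hf (fun _ p q _ _ => hle' p q) (fun _ _ p q _ _ _ => hle' p q)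
  obtain ⟨⟨n, c⟩, hd, ⟨φ⟩⟩ := classify hP
  have hm := hf'.comp_inj (H' := LG n c) φ.symm φ.symm.injective
    (fun a b hab => Or.inl (φ.symm.map_adj_iff.2 hab))
  rcases hcs.main n c hd (hP.iso φ) _ hm with h | h
  · exact hl _ cA fullA h
  · exact hl _ cB fullB h

theorem core_tri {V : Type} [Finite V] {G : SimpleGraph V} (hG : IsMaxnil G) (s : Fin 4 → V)
    (hs : Function.Injective s) (hmin : IsMinimalVertexCut G (Set.range s))
    (h01 : G.Adj (s 0) (s 1)) (h02 : G.Adj (s 0) (s 2)) (h12 : G.Adj (s 1) (s 2)) :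
    ∀ i j, i ≠ j → G.Adj (s i) (s j) := by
  have hne : ∀ i j, i ≠ j → s i ≠ s j := fun i j h h' => h (hs h')
  refine core hG s hs hmin ?_ ?_
  · intro A B C cA cB cC sA sB sC dAB dAC dBC fA fB fC
    have tt : ∀ (X : Set V), (∀ i, ∃ a ∈ X, G.Adj (s i) a) → ∀ i, Touch G {s i} X := by
      intro X hX i
      obtain ⟨a, ha, h⟩ := hX i
      exact ⟨s i, rfl, a, ha, h⟩
    have ds : ∀ (X : Set V), (∀ i, s i ∉ X) → ∀ i v, v ∈ X → v ∉ ({s i} : Set V) := by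
      rintro X hX i v hv rfl
      exact hX i hv
    have ts : ∀ i j, G.Adj (s i) (s j) → Touch G {s i} {s j} :=
      fun i j h => ⟨s i, rfl, s j, rfl, h⟩
    have dss : ∀ i j, i ≠ j → ∀ v, v ∈ ({s i} : Set V) → v ∉ ({s j} : Set V) := by
      rintro i j hij v rfl h
      exact hne i j hij h
    refine hG.1 _ (IsPetersenFamily.k6.deltaY (a := 0) (b := 1) (c := 2) (by decide) (by decide)
      (by decide)) (isMinor_iff.2 ⟨_, model_P7 (f := ![A, B, C, {s 0}, {s 1}, {s 2}])
      (X := {s 3}) ?_ (Conn.singleton _ _) ?_ ?_ ?_ (tt A fA 3) (tt B fB 3) (tt C fC 3)⟩)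
    · intro i
      fin_cases i
      exacts [cA, cB, cC, Conn.singleton _ _, Conn.singleton _ _, Conn.singleton _ _]
    · intro i j hij
      fin_cases i <;> fin_cases j <;>
        first
        | (exfalso; revert hij; decide)
        | exact dAB
        | exact dAC
        | exact dBC
        | exact ds A sA _
        | exact ds B sB _
        | exact ds C sC _
        | exact dss _ _ (by decide)
    · intro i
      fin_cases i
      · rintro v rfl h; exact sA _ h
      · rintro v rfl h; exact sB _ h
      · rintro v rfl h; exact sC _ h
      · exact dss _ _ (by decide)
      · exact dss _ _ (by decide)
      · exact dss _ _ (by decide)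
    · intro i j hij hj
      fin_cases i <;> fin_cases j <;>
        first
        | (exfalso; revert hij; decide)
        | (exfalso; revert hj; decide)
        | exact (tt A fA _).symm
        | exact (tt B fB _).symm
        | exact (tt C fC _).symm
        | exact ts _ _ h01
        | exact ts _ _ h02
        | exact ts _ _ h12
  · intro A cA fA
    refine tri_lift (t := s 3) hG.1 cA fA ⟨3, rfl⟩ ?_ ?_
    · rintro p q (h | h) h'
      · exact absurd h h'
      · exact h.2
    · rintro p q (h | ⟨h, ⟨i, rfl⟩, ⟨j, rfl⟩⟩) h'
      · exact absurd h h'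
      · have h10 := h01.symm
        have h20 := h02.symm
        have h21 := h12.symm
        fin_cases i <;> fin_cases j <;>
          first
          | exact Or.inl rfl
          | exact Or.inr rfl
          | exact absurd rfl h
          | (exfalso; exact h' (by assumption))

theorem core_claw {V : Type} [Finite V] {G : SimpleGraph V} (hG : IsMaxnil G) (s : Fin 4 → V)
    (hs : Function.Injective s) (hmin : IsMinimalVertexCut G (Set.range s))
    (h01 : G.Adj (s 0) (s 1)) (h02 : G.Adj (s 0) (s 2)) (h03 : G.Adj (s 0) (s 3)) :
    ∀ i j, i ≠ j → G.Adj (s i) (s j) := by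
  have hne : ∀ i j, i ≠ j → s i ≠ s j := fun i j h h' => h (hs h')
  refine core hG s hs hmin ?_ ?_
  · intro A B C cA cB cC sA sB sC dAB dAC dBC fA fB fC
    have tt : ∀ (X : Set V), (∀ i, ∃ a ∈ X, G.Adj (s i) a) → ∀ i, Touch G {s i} X := by
      intro X hX i
      obtain ⟨a, ha, h⟩ := hX i
      exact ⟨s i, rfl, a, ha, h⟩
    have ds : ∀ (X : Set V), (∀ i, s i ∉ X) → ∀ i v, v ∈ X → v ∉ ({s i} : Set V) := by
      rintro X hX i v hv rfl
      exact hX i hv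
    have ds' : ∀ (X : Set V), (∀ i, s i ∉ X) → ∀ i v, v ∈ ({s i} : Set V) → v ∉ X := by
      rintro X hX i v rfl hv
      exact hX i hv
    have ts : ∀ i j, G.Adj (s i) (s j) → Touch G {s i} {s j} :=
      fun i j h => ⟨s i, rfl, s j, rfl, h⟩
    have dss : ∀ i j, i ≠ j → ∀ v, v ∈ ({s i} : Set V) → v ∉ ({s j} : Set V) := by
      rintro i j hij v rfl h
      exact hne i j hij h
    refine hG.1 _ pet_K331 (isMinor_iff.2
      ⟨![A, B, {s 1}, {s 2}, {s 0}, {s 3}, C], model_fin ?_ ?_ ?_⟩)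
    · intro i
      fin_cases i
      exacts [cA, cB, Conn.singleton _ _, Conn.singleton _ _, Conn.singleton _ _,
        Conn.singleton _ _, cC]
    · intro i j hij
      fin_cases i <;> fin_cases j <;>
        first
        | (exfalso; revert hij; decide)
        | exact dAB
        | exact dAC
        | exact dBC
        | exact ds A sA _
        | exact ds B sB _
        | exact ds' C sC _
        | exact dss _ _ (by decide)
    · intro i j hij hadj
      fin_cases i <;> fin_cases j <;>
        first
        | (exfalso; revert hij; decide)
        | exact (tt A fA _).symm
        | exact (tt B fB _).symm
        | exact tt C fC _
        | exact (ts _ _ h01).symm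
        | exact (ts _ _ h02).symm
        | exact ts _ _ h03
        | (exfalso; revert hadj; decide +kernel)
  · intro A cA fA
    refine claw_lift (a := s 1) (b := s 2) (c := s 3) hG.1 cA fA ⟨1, rfl⟩ ⟨2, rfl⟩ ⟨3, rfl⟩ ?_
    rintro p q (h | ⟨h, ⟨i, rfl⟩, ⟨j, rfl⟩⟩) h'
    · exact absurd h h'
    · have h10 := h01.symm
      have h20 := h02.symm
      have h30 := h03.symm
      refine ⟨h, ?_⟩
      fin_cases i <;> fin_cases j <;>
        first
        | exact absurd rfl h
        | (exfalso; exact h' (by assumption))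
        | simp

/-! ### The final case analysis -/

theorem range4 {V : Type} (a b c d : V) : Set.range ![a, b, c, d] = {a, b, c, d} := by
  ext v
  simp [eq_comm]
  tauto

theorem inj4 {V : Type} {a b c d : V} (hab : a ≠ b) (hac : a ≠ c) (had : a ≠ d) (hbc : b ≠ c)
    (hbd : b ≠ d) (hcd : c ≠ d) : Function.Injective ![a, b, c, d] := by
  intro i j hij
  fin_cases i <;> fin_cases j <;> simp_all

theorem tri4 {V : Type} [Finite V] {G : SimpleGraph V} (hG : IsMaxnil G) {S : Set V}
    (hmin : IsMinimalVertexCut G S) (a b c d : V) (hS : S = {a, b, c, d})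
    (hab : a ≠ b) (hac : a ≠ c) (had : a ≠ d) (hbc : b ≠ c) (hbd : b ≠ d) (hcd : c ≠ d)
    (h1 : G.Adj a b) (h2 : G.Adj a c) (h3 : G.Adj b c) :
    ∀ p ∈ S, ∀ q ∈ S, p ≠ q → G.Adj p q := by
  subst hS
  rw [← range4] at hmin ⊢
  have := core_tri hG _ (inj4 hab hac had hbc hbd hcd) hmin h1 h2 h3
  rintro _ ⟨i, rfl⟩ _ ⟨j, rfl⟩ hne
  exact this i j fun h => hne (by rw [h])

theorem claw4 {V : Type} [Finite V] {G : SimpleGraph V} (hG : IsMaxnil G) {S : Set V}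
    (hmin : IsMinimalVertexCut G S) (a b c d : V) (hS : S = {a, b, c, d})
    (hab : a ≠ b) (hac : a ≠ c) (had : a ≠ d) (hbc : b ≠ c) (hbd : b ≠ d) (hcd : c ≠ d)
    (h1 : G.Adj a b) (h2 : G.Adj a c) (h3 : G.Adj a d) :
    ∀ p ∈ S, ∀ q ∈ S, p ≠ q → G.Adj p q := by
  subst hS
  rw [← range4] at hmin ⊢
  have := core_claw hG _ (inj4 hab hac had hbc hbd hcd) hmin h1 h2 h3
  rintro _ ⟨i, rfl⟩ _ ⟨j, rfl⟩ hne
  exact this i j fun h => hne (by rw [h])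

theorem cyc4 {V : Type} {G : SimpleGraph V} {S : Set V} (a b c d : V) (hS : S = {a, b, c, d})
    (hab : a ≠ b) (hac : a ≠ c) (had : a ≠ d) (hbc : b ≠ c) (hbd : b ≠ d) (hcd : c ≠ d)
    (h1 : ¬ G.Adj a c) (h2 : ¬ G.Adj b d) :
    ∃ f : G.induce S →g SimpleGraph.cycleGraph 4, Function.Injective f := by
  classical
  subst hS
  obtain ⟨r, ra, rb, rc, rd⟩ : ∃ r : V → Fin 4, r a = 0 ∧ r b = 1 ∧ r c = 2 ∧ r d = 3 := by
    refine ⟨fun v => if v = a then 0 else if v = b then 1 else if v = c then 2 else 3,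
      ?_, ?_, ?_, ?_⟩
    · simp
    · simp [hab.symm]
    · simp [hac.symm, hbc.symm]
    · simp [had.symm, hbd.symm, hcd.symm]
  have h1' : ¬ G.Adj c a := fun h => h1 h.symm
  have h2' : ¬ G.Adj d b := fun h => h2 h.symm
  refine ⟨⟨fun v => r v.1, ?_⟩, ?_⟩
  · rintro ⟨p, hp⟩ ⟨q, hq⟩ hpq
    have hpq : G.Adj p q := hpq
    change (SimpleGraph.cycleGraph 4).Adj (r p) (r q)
    rcases hp with rfl | rfl | rfl | rfl <;> rcases hq with rfl | rfl | rfl | rfl <;>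
      first
      | exact absurd hpq (by assumption)
      | exact absurd rfl hpq.ne
      | (simp only [ra, rb, rc, rd]; decide)
  · rintro ⟨p, hp⟩ ⟨q, hq⟩ hpq
    have hr : r p = r q := hpq
    clear hpq
    apply Subtype.ext
    change p = q
    rcases hp with rfl | rfl | rfl | rfl <;> rcases hq with rfl | rfl | rfl | rfl <;>
      first
      | rfl
      | (exfalso; simp only [ra, rb, rc, rd] at hr; revert hr; decide)

theorem perm4 {V : Type} (x y z t : V) :
    ({x, y, z, t} : Set V) = {x, z, y, t} ∧
    ({x, y, z, t} : Set V) = {x, y, t, z} ∧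
    ({x, y, z, t} : Set V) = {x, z, t, y} ∧
    ({x, y, z, t} : Set V) = {z, x, y, t} ∧
    ({x, y, z, t} : Set V) = {y, x, z, t} ∧
    ({x, y, z, t} : Set V) = {t, x, y, z} ∧
    ({x, y, z, t} : Set V) = {y, z, t, x} := by
  refine ⟨?_, ?_, ?_, ?_, ?_, ?_, ?_⟩ <;> ext v <;>
    simp only [Set.mem_insert_iff, Set.mem_singleton_iff] <;> tauto

/-- If `{x, y, z, t}` is a minimal vertex cut set of a maxnil graph `G` consisting of
four distinct vertices, then the subgraph induced by `{x, y, z, t}` is either a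
complete graph `K₄` or a subgraph of the 4-cycle `C₄`. -/
theorem stmt_10 {V : Type} [Fintype V] (G : SimpleGraph V) (x y z t : V)
    (hG : IsMaxnil G)
    (hxy : x ≠ y) (hxz : x ≠ z) (hxt : x ≠ t) (hyz : y ≠ z) (hyt : y ≠ t) (hzt : z ≠ t)
    (hmin : IsMinimalVertexCut G {x, y, z, t}) :
    (G.Adj x y ∧ G.Adj x z ∧ G.Adj x t ∧ G.Adj y z ∧ G.Adj y t ∧ G.Adj z t) ∨
    ∃ f : G.induce ({x, y, z, t} : Set V) →g SimpleGraph.cycleGraph 4,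
      Function.Injective f := by
  obtain ⟨p1, p2, p3, p4, p5, p6, p7⟩ := perm4 x y z t
  by_cases e1 : ¬ G.Adj x z ∧ ¬ G.Adj y t
  · exact Or.inr (cyc4 x y z t rfl hxy hxz hxt hyz hyt hzt e1.1 e1.2)
  by_cases e2 : ¬ G.Adj x y ∧ ¬ G.Adj z t
  · exact Or.inr (cyc4 x z y t p1 hxz hxy hxt hyz.symm hzt hyt e2.1 e2.2)
  by_cases e3 : ¬ G.Adj x t ∧ ¬ G.Adj y z
  · exact Or.inr (cyc4 x y t z p2 hxy hxt hxz hyt hyz hzt.symm e3.1 e3.2)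
  left
  have key : ∀ p ∈ ({x, y, z, t} : Set V), ∀ q ∈ ({x, y, z, t} : Set V), p ≠ q → G.Adj p q := by
    have f1 : G.Adj x z ∨ G.Adj y t := by
      by_contra h; push Not at h; exact e1 h
    have f2 : G.Adj x y ∨ G.Adj z t := by
      by_contra h; push Not at h; exact e2 h
    have f3 : G.Adj x t ∨ G.Adj y z := by
      by_contra h; push Not at h; exact e3 h
    rcases f1 with g1 | g1 <;> rcases f2 with g2 | g2 <;> rcases f3 with g3 | g3
    · exact claw4 hG hmin x y z t rfl hxy hxz hxt hyz hyt hzt g2 g1 g3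
    · exact tri4 hG hmin x y z t rfl hxy hxz hxt hyz hyt hzt g2 g1 g3
    · exact tri4 hG hmin x z t y p3 hxz hxt hxy hzt hyz.symm hyt.symm g1 g3 g2
    · exact claw4 hG hmin z x y t p4 hxz.symm hyz.symm hzt hxy hxt hyt
        g1.symm g3.symm g2
    · exact tri4 hG hmin x y t z p2 hxy hxt hxz hyt hyz hzt.symm g2 g3 g1
    · exact claw4 hG hmin y x z t p5 hxy.symm hyz hyt hxz hxt hzt
        g2.symm g3 g1
    · exact claw4 hG hmin t x y z p6 hxt.symm hyt.symm hzt.symm hxy hxz hyz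
        g3.symm g1.symm g2.symm
    · exact tri4 hG hmin y z t x p7 hyz hyt hxy.symm hzt hxz.symm hxt.symm
        g3 g1 g2
  exact ⟨key x (by simp) y (by simp) hxy, key x (by simp) z (by simp) hxz,
    key x (by simp) t (by simp) hxt, key y (by simp) z (by simp) hyz,
    key y (by simp) t (by simp) hyt, key z (by simp) t (by simp) hzt⟩
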